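/- Let A be the Plücker algebra of the Grassmannian G(r,E) with dim E = n, and let m be its irrelevant maximal ideal. Then H^1_m(Ω_{A/k}) = 0. -/

import Mathlib

/-!
STATEMENT 2: Let `A` be the Plücker algebra of the Grassmannian `G(r,E)` with
`dim E = n`, and let `m` be its irrelevant maximal ideal.  Then
`H^1_m(Ω_{A/k}) = 0`.
-/

noncomputable section
set_option synthInstance.maxHeartbeats 1000000

namespace Plucker

variable (k : Type) [Field k] (r n : ℕ)

/-- The polynomial ring `S = k[x_{ij} : 1 ≤ i ≤ n, 1 ≤ j ≤ r]`, the coordinate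
ring of the space of `n × r` matrices. -/
abbrev S := MvPolynomial (Fin n × Fin r) k

/-- The maximal (`r × r`) minor of the generic `n × r` matrix `(x_{ij})`
corresponding to a choice `f : Fin r → Fin n` of `r` rows. -/
def minor (f : Fin r → Fin n) : S k r n :=
  (Matrix.of fun i j : Fin r => MvPolynomial.X (f i, j)).det

/-- The Plücker algebra of the Grassmannian `G(r,n)`: the subalgebra of `S`
generated by the maximal minors of the generic `n × r` matrix; equivalently the
ring of invariants `S^{SL_r}`, i.e. the homogeneous coordinate ring of `G(r,n)`
in the Plücker embedding. -/
def algebra : Subalgebra k (S k r n) :=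
  Algebra.adjoin k (Set.range (minor k r n))

instance : CommRing (algebra k r n) := inferInstance
instance : Algebra k (algebra k r n) := inferInstance

/-- The irrelevant maximal ideal of the Plücker algebra: the ideal generated by
the Plücker coordinates (the maximal minors). -/
def irrelevant : Ideal (algebra k r n) :=
  Ideal.span { a : algebra k r n | ∃ f : Fin r → Fin n, (a : S k r n) = minor k r n f }

end Plucker

section

open CategoryTheory Limits Opposite
universe u

theorem HomologicalComplex.unop_homologyMap_eq_zero {R : Type u} [Ring R]
    {K L : ChainComplex (ModuleCat.{u} R)ᵒᵖ ℕ} (φ : K ⟶ L)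
    (c : (L.opcycles 1).unop) (h : (K.X 0).unop)
    (hc : (φ.f 1).unop ((L.pOpcycles 1).unop c) = (K.d 1 0).unop h) :
    (HomologicalComplex.homologyMap φ 1).unop ((L.homologyι 1).unop c) = 0 := by
  have h1 : (L.homologyι 1).unop ≫ (HomologicalComplex.homologyMap φ 1).unop =
      (HomologicalComplex.opcyclesMap φ 1).unop ≫ (K.homologyι 1).unop := by
    rw [← unop_comp, ← unop_comp, HomologicalComplex.homologyι_naturality]
  have h2 : (HomologicalComplex.opcyclesMap φ 1).unop c = (K.fromOpcycles 1 0).unop h := by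
    have hm : Mono (K.pOpcycles 1).unop := inferInstance
    rw [ModuleCat.mono_iff_injective] at hm
    apply hm
    have h3 : (HomologicalComplex.opcyclesMap φ 1).unop ≫ (K.pOpcycles 1).unop =
       (L.pOpcycles 1).unop ≫ (φ.f 1).unop := by
      rw [← unop_comp, ← unop_comp, HomologicalComplex.p_opcyclesMap]
    have h4 : (K.fromOpcycles 1 0).unop ≫ (K.pOpcycles 1).unop = (K.d 1 0).unop := by
      rw [← unop_comp, HomologicalComplex.p_fromOpcycles]
    have h3' := congr($h3 c)
    have h4' := congr($h4 h)
    simp only [ModuleCat.comp_apply] at h3' h4'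
    rw [h3', h4', hc]
  have h5 : (K.fromOpcycles 1 0).unop ≫ (K.homologyι 1).unop = 0 := by
    rw [← unop_comp, HomologicalComplex.homologyι_comp_fromOpcycles, unop_zero]
  have h1' := congr($h1 c)
  have h5' := congr($h5 h)
  simp only [ModuleCat.comp_apply] at h1' h5'
  rw [h1', h2, h5']
  simp

theorem ext_one_exists_cocycle {R : Type u} [CommRing R] {Y : ModuleCat.{u} R}
    (Q : ProjectiveResolution Y) (M : ModuleCat.{u} R)
    (e : ((Ext R (ModuleCat.{u} R) 1).obj (op Y)).obj M) :
    ∃ z : Q.complex.X 1 ⟶ M, Q.complex.d 2 1 ≫ z = 0 ∧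
      ∀ (X : ModuleCat.{u} R) (f : X ⟶ Y) (P : ProjectiveResolution X)
        (φ : P.complex ⟶ Q.complex) (_ : φ.f 0 ≫ Q.π.f 0 = P.π.f 0 ≫ f)
        (h : P.complex.X 0 ⟶ M) (_ : φ.f 1 ≫ z = P.complex.d 1 0 ≫ h),
        (((Ext R (ModuleCat.{u} R) 1).map f.op).app M) e = 0 := by
  let F := ((linearYoneda R (ModuleCat.{u} R)).obj M).rightOp
  let L := (F.mapHomologicalComplex _).obj Q.complex
  let e' : (L.homology 1).unop := (Q.isoLeftDerivedObj F 1).inv.unop e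
  have hs : Epi (L.homologyι 1).unop := inferInstance
  rw [ModuleCat.epi_iff_surjective] at hs
  obtain ⟨c, hc⟩ := hs e'
  refine ⟨(L.pOpcycles 1).unop c, ?_, ?_⟩
  · have h1 : (L.pOpcycles 1).unop ≫ (L.d 2 1).unop = 0 := by
      rw [← unop_comp, HomologicalComplex.d_pOpcycles, unop_zero]
    exact congr($h1 c)
  · intro X f P φ comm h hh
    have h1 := congrArg Quiver.Hom.unop (P.isoLeftDerivedObj_inv_naturality f Q φ comm F 1)
    have h5 := HomologicalComplex.unop_homologyMap_eq_zero
      ((F.mapHomologicalComplex (ComplexShape.down ℕ)).map φ) c h hh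
    have h6 : (Q.isoLeftDerivedObj F 1).inv.unop e = (L.homologyι 1).unop c := hc.symm
    have hm : Mono (P.isoLeftDerivedObj F 1).inv.unop := inferInstance
    rw [ModuleCat.mono_iff_injective] at hm
    apply hm
    refine Eq.trans ?_ (map_zero (P.isoLeftDerivedObj F 1).inv.unop.hom).symm
    refine Eq.trans congr($h1 e) (Eq.trans ?_ h5)
    rw [← h6]
    rfl

theorem ext_one_factor_eq_zero {R : Type u} [CommRing R] (I : Ideal R) (M : ModuleCat.{u} R)
    (e : ((Ext R (ModuleCat.{u} R) 1).obj (op (ModuleCat.of R (R ⧸ I)))).obj M) :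
    ∃ φ : I →ₗ[R] M, ∀ (I' : Ideal R) (hI : I' ≤ I) (ω : M)
      (_ : ∀ (x : R) (hx : x ∈ I'), φ ⟨x, hI hx⟩ = x • ω),
      (((Ext R (ModuleCat.{u} R) 1).map (ModuleCat.ofHom (Submodule.mapQ I' I LinearMap.id hI) :
        ModuleCat.of R (R ⧸ I') ⟶ ModuleCat.of R (R ⧸ I)).op).app M) e = 0 := by
  let Q := projectiveResolution (ModuleCat.of R (R ⧸ I))
  obtain ⟨z, hz, H⟩ := ext_one_exists_cocycle Q M e
  let d : Q.complex.X 1 →ₗ[R] Q.complex.X 0 := (Q.complex.d 1 0).hom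
  let π : Q.complex.X 0 →ₗ[R] (R ⧸ I) := (Q.π.f 0).hom
  have hπ : Function.Surjective π := (ModuleCat.epi_iff_surjective (Q.π.f 0)).1 inferInstance
  have hex0 : ∀ y, π y = 0 → ∃ x, d x = y := by
    have := Q.exact₀
    rw [ShortComplex.moduleCat_exact_iff] at this
    exact this
  have hdπ : ∀ x, π (d x) = 0 := by
    intro x
    exact congr($(Q.complex_d_comp_π_f_zero) x)
  have hex1 : LinearMap.ker d ≤ LinearMap.ker z.hom := by
    intro y hy
    have := Q.exact_succ 0
    rw [ShortComplex.moduleCat_exact_iff] at this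
    obtain ⟨x, hx⟩ := this y hy
    have h2 := congr($hz x)
    rw [LinearMap.mem_ker, ← hx]
    exact h2
  let ψ : LinearMap.range d →ₗ[R] M :=
    (Submodule.liftQ _ z.hom hex1) ∘ₗ d.quotKerEquivRange.symm.toLinearMap
  have hψ : ∀ x, ψ ⟨d x, x, rfl⟩ = z.hom x := by
    intro x
    have : d.quotKerEquivRange.symm ⟨d x, x, rfl⟩ = Submodule.Quotient.mk x := by
      rw [LinearEquiv.symm_apply_eq]; rfl
    simp [ψ, this]
  obtain ⟨ρ, hρ⟩ := Module.projective_lifting_property π (Submodule.mkQ I) hπ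
  have hρ' : ∀ x, π (ρ x) = Submodule.Quotient.mk x := fun x => congr($hρ x)
  have hρI : ∀ x : I, ρ x ∈ LinearMap.range d := by
    intro x
    apply hex0
    rw [hρ', Submodule.Quotient.mk_eq_zero]
    exact x.2
  refine ⟨ψ ∘ₗ LinearMap.codRestrict _ (ρ ∘ₗ I.subtype) hρI, ?_⟩
  intro I' hI ω hω
  let P := projectiveResolution (ModuleCat.of R (R ⧸ I'))
  let f : ModuleCat.of R (R ⧸ I') ⟶ ModuleCat.of R (R ⧸ I) :=
    ModuleCat.ofHom (Submodule.mapQ I' I LinearMap.id hI)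
  let φ := ProjectiveResolution.lift f P Q
  have comm : φ.f 0 ≫ Q.π.f 0 = P.π.f 0 ≫ f := ProjectiveResolution.lift_commutes_zero f P Q
  let φ0 : P.complex.X 0 →ₗ[R] Q.complex.X 0 := (φ.f 0).hom
  let φ1 : P.complex.X 1 →ₗ[R] Q.complex.X 1 := (φ.f 1).hom
  let dP : P.complex.X 1 →ₗ[R] P.complex.X 0 := (P.complex.d 1 0).hom
  let πP : P.complex.X 0 →ₗ[R] (R ⧸ I') := (P.π.f 0).hom
  have hdπP : ∀ x, πP (dP x) = 0 := by
    intro x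
    exact congr($(P.complex_d_comp_π_f_zero) x)
  have hsq : ∀ x, d (φ1 x) = φ0 (dP x) := by
    intro x
    exact congr($(φ.comm 1 0) x)
  have hc0 : ∀ x, π (φ0 x) = f (πP x) := fun x => congr($comm x)
  have hproj : Module.Projective R (P.complex.X 0) :=
    (IsProjective.iff_projective _).2 (P.projective 0)
  obtain ⟨g, hg⟩ := Module.projective_lifting_property (Submodule.mkQ I') πP
    (Submodule.mkQ_surjective I')
  have hg' : ∀ x, Submodule.Quotient.mk (g x) = πP x := fun x => congr($hg x)
  have hr : ∀ x, (φ0 - ρ ∘ₗ g) x ∈ LinearMap.range d := by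
    intro x
    apply hex0
    rw [LinearMap.sub_apply, map_sub, hc0, LinearMap.comp_apply, hρ', ← hg']
    exact sub_self _
  obtain ⟨k, hk⟩ := Module.projective_lifting_property d.rangeRestrict
    (LinearMap.codRestrict _ (φ0 - ρ ∘ₗ g) hr) (LinearMap.surjective_rangeRestrict d)
  have hk' : ∀ x, d (k x) = φ0 x - ρ (g x) := fun x => congr(($hk x).1)
  refine H _ f P φ comm (ModuleCat.ofHom (z.hom ∘ₗ k + (LinearMap.toSpanSingleton R M ω) ∘ₗ g)) ?_
  ext x
  have hgx : g (dP x) ∈ I' := by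
    rw [← Submodule.Quotient.mk_eq_zero, hg', hdπP]
  have h1 := hω _ hgx
  simp only [LinearMap.comp_apply] at h1
  change z.hom (φ1 x) = z.hom (k (dP x)) + g (dP x) • ω
  rw [← hψ, ← hψ, ← h1, ← map_add]
  congr 1
  ext
  change d (φ1 x) = d (k (dP x)) + ρ (g (dP x))
  rw [hsq, hk']
  abel

theorem localCohomology_one_subsingleton {R : Type} [CommRing R] (J : Ideal R)
    (M : Type) [AddCommGroup M] [Module R M]
    (H : ∀ (t : ℕ) (φ : ↥(J ^ t) →ₗ[R] M), ∃ s, ∃ hst : t ≤ s, ∃ ω : M,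
      ∀ (x : R) (hx : x ∈ J ^ s), φ ⟨x, Ideal.pow_le_pow_right hst hx⟩ = x • ω) :
    Subsingleton ((localCohomology J 1).obj (ModuleCat.of R M)) := by
  let D := localCohomology.diagram (localCohomology.idealPowersDiagram J) 1
  let E := (evaluation (ModuleCat.{0} R) (ModuleCat.{0} R)).obj (ModuleCat.of R M)
  have hc : IsColimit (E.mapCocone (colimit.cocone D)) :=
    isColimitOfPreserves E (colimit.isColimit D)
  refine subsingleton_of_forall_eq 0 fun x => ?_
  obtain ⟨j, e, he⟩ := Concrete.isColimit_exists_rep (D ⋙ E) hc x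
  obtain ⟨φ, hφ⟩ := ext_one_factor_eq_zero (J ^ (unop (unop j))) (ModuleCat.of R M) e
  obtain ⟨s, hst, ω, hω⟩ := H _ φ
  have h0 := hφ _ (Ideal.pow_le_pow_right hst) ω hω
  let i : j ⟶ op (op s) := (homOfLE hst).op.op
  have hw := (E.mapCocone (colimit.cocone D)).w i
  have hw' := congr($hw e)
  rw [← he]
  refine hw'.symm.trans ?_
  refine Eq.trans ?_ (map_zero ((E.mapCocone (colimit.cocone D)).ι.app (op (op s))).hom)
  exact congrArg ((E.mapCocone (colimit.cocone D)).ι.app (op (op s))).hom h0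

end

section

open MvPolynomial

section DifferentialOperators

variable {k : Type*} [Field k] {σ : Type*}

theorem pderiv_comm_apply (p q : σ) (G : MvPolynomial σ k) :
    pderiv p (pderiv q G) = pderiv q (pderiv p G) := by
  classical
  have h : ⁅(pderiv p : Derivation k (MvPolynomial σ k) (MvPolynomial σ k)),
      (pderiv q : Derivation k (MvPolynomial σ k) (MvPolynomial σ k))⁆ = 0 := by
    apply MvPolynomial.derivation_ext
    intro i
    by_cases h1 : q = i <;> by_cases h2 : p = i <;>
      simp [Derivation.commutator_apply, pderiv_X, h1, h2]
  have h2 := congr($h G)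
  rw [Derivation.commutator_apply] at h2
  exact sub_eq_zero.1 h2

open scoped IsMulCommutative in
/-- The action of a polynomial as a constant coefficient differential operator. -/
def diffOp : MvPolynomial σ k →ₐ[k] Module.End k (MvPolynomial σ k) :=
  haveI := Algebra.isMulCommutative_adjoin k
    (s := Set.range fun p : σ => ((pderiv p).toLinearMap : Module.End k (MvPolynomial σ k))) (by
      rintro _ ⟨p, rfl⟩ _ ⟨q, rfl⟩
      exact LinearMap.ext fun G => pderiv_comm_apply p q G)
  (Subalgebra.val _).comp (aeval (R := k) (S₁ := ↥(Algebra.adjoin k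
    (Set.range fun p : σ => ((pderiv p).toLinearMap : Module.End k (MvPolynomial σ k)))))
    fun p => ⟨_, Algebra.subset_adjoin ⟨p, rfl⟩⟩)

theorem diffOp_X (p : σ) (G : MvPolynomial σ k) : diffOp (X p) G = pderiv p G := by
  simp [diffOp]

theorem diffOp_mul_X (P : MvPolynomial σ k) (p : σ) (G : MvPolynomial σ k) :
    diffOp (P * X p) G = diffOp P (pderiv p G) := by
  rw [map_mul, Module.End.mul_apply, diffOp_X]

theorem pderiv_diffOp (P : MvPolynomial σ k) (p : σ) (G : MvPolynomial σ k) :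
    pderiv p (diffOp P G) = diffOp (P * X p) G := by
  rw [mul_comm, map_mul, Module.End.mul_apply, diffOp_X]

theorem diffOp_X_mul (P : MvPolynomial σ k) (p : σ) (G : MvPolynomial σ k) :
    diffOp P (X p * G) = X p * diffOp P G + diffOp (pderiv p P) G := by
  classical
  induction P using MvPolynomial.induction_on generalizing G with
  | C a => simp [algHom_C, Module.algebraMap_end_apply]
  | add P Q hP hQ => simp only [map_add, LinearMap.add_apply, hP, hQ]; ring
  | mul_X P q hP =>
    rw [diffOp_mul_X, diffOp_mul_X, Derivation.leibniz, Derivation.leibniz]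
    simp only [smul_eq_mul, map_add, LinearMap.add_apply, hP, pderiv_X]
    rw [mul_comm (X q) (pderiv p P), diffOp_mul_X]
    by_cases h : p = q
    · subst h; simp; ring
    · rw [Pi.single_eq_of_ne h, Pi.single_eq_of_ne (Ne.symm h)]; simp

end DifferentialOperators

theorem Derivation.map_prod_univ {R A : Type*} [CommRing R] [CommRing A] [Algebra R A]
    (D : Derivation R A A) {ι : Type*} [Fintype ι] [DecidableEq ι] (f : ι → A) :
    D (∏ i, f i) = ∑ i, ∏ j, Function.update f i (D (f i)) j := by
  have h : ∀ s : Finset ι, D (∏ i ∈ s, f i) = ∑ i ∈ s, (∏ j ∈ s.erase i, f j) * D (f i) := by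
    intro s
    induction s using Finset.induction_on with
    | empty => simp
    | insert a s ha ih =>
      rw [Finset.prod_insert ha, Derivation.leibniz, ih, Finset.sum_insert ha,
        Finset.erase_insert ha, smul_eq_mul, smul_eq_mul, Finset.mul_sum, add_comm]
      congr 1
      refine Finset.sum_congr rfl fun i hi => ?_
      rw [Finset.erase_insert_of_ne (by rintro rfl; exact ha hi),
        Finset.prod_insert (by simp [ha]), mul_assoc]
  rw [h]
  refine Finset.sum_congr rfl fun i _ => ?_
  rw [Finset.prod_update_of_mem (Finset.mem_univ i), mul_comm, Finset.sdiff_singleton_eq_erase]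

namespace Plucker

section Polarization

variable {k : Type} [Field k] {r n : ℕ}

/-- The infinitesimal column operation `∑ᵢ x_{ia} ∂/∂x_{ib}`. -/
def colD (a b : Fin r) : Derivation k (S k r n) (S k r n) :=
  ∑ i, (X (i, a) : S k r n) • pderiv (i, b)

theorem colD_apply (a b : Fin r) (G : S k r n) :
    colD a b G = ∑ i, X (i, a) * pderiv (i, b) G := by
  rw [← Derivation.coeFnAddMonoidHom_apply, colD, map_sum, Finset.sum_apply]
  rfl

theorem colD_X (a b c : Fin r) (i : Fin n) :
    colD a b (X (i, c) : S k r n) = if c = b then X (i, a) else 0 := by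
  simp only [colD_apply, pderiv_X, Pi.single_apply, Prod.mk.injEq]
  split_ifs with h <;> simp [h]

/-- The normally ordered product of the infinitesimal column operations. -/
def normalProd {m : ℕ} (a b : Fin m → Fin r) (G : S k r n) : S k r n :=
  ∑ g : Fin m → Fin n, (∏ s, X (g s, a s)) * diffOp (∏ s, X (g s, b s)) G

theorem colD_prod {m : ℕ} (a b : Fin r) (g : Fin m → Fin n) (c : Fin m → Fin r) :
    colD a b (∏ s, X (g s, c s) : S k r n) =
      ∑ s, if c s = b then ∏ t, X (g t, Function.update c s a t) else 0 := by
  rw [Derivation.map_prod_univ]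
  refine Finset.sum_congr rfl fun s _ => ?_
  rw [colD_X]
  split_ifs with h
  · refine Finset.prod_congr rfl fun t _ => ?_
    by_cases hts : t = s
    · subst hts; simp
    · simp [hts]
  · exact Finset.prod_eq_zero (Finset.mem_univ s) (by simp)

theorem diffOp_colD (P G : S k r n) (a b : Fin r) :
    diffOp P (colD a b G) = colD a b (diffOp P G) + diffOp (colD b a P) G := by
  simp only [colD_apply, map_sum, LinearMap.sum_apply, ← Finset.sum_add_distrib]
  refine Finset.sum_congr rfl fun i _ => ?_
  rw [diffOp_X_mul, pderiv_diffOp, ← diffOp_mul_X, ← diffOp_mul_X, mul_comm (pderiv _ P)]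

theorem normalProd_succ {m : ℕ} (a b : Fin (m + 1) → Fin r) (G : S k r n) :
    normalProd a b G = normalProd (a ∘ Fin.succ) (b ∘ Fin.succ) (colD (a 0) (b 0) G) -
      ∑ s, if b (Fin.succ s) = a 0 then
        normalProd (a ∘ Fin.succ) (Function.update (b ∘ Fin.succ) s (b 0)) G else 0 := by
  have h1 : normalProd a b G = ∑ g : Fin m → Fin n, ∑ i : Fin n,
      (∏ s, X (g s, a (Fin.succ s))) * (X (i, a 0) * 
        pderiv (i, b 0) (diffOp (∏ s, X (g s, b (Fin.succ s))) G)) := by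
    rw [Finset.sum_comm, normalProd, ← (Fin.consEquiv fun _ => Fin n).sum_comp,
      Fintype.sum_prod_type]
    refine Finset.sum_congr rfl fun i _ => Finset.sum_congr rfl fun g _ => ?_
    rw [pderiv_diffOp, Fin.prod_univ_succ, Fin.prod_univ_succ]
    simp only [Fin.consEquiv_apply, Fin.cons_zero, Fin.cons_succ]
    rw [mul_comm (X (i, b 0))]
    ring
  have h2 : ∀ g : Fin m → Fin n, colD (a 0) (b 0) (diffOp (∏ s, X (g s, b (Fin.succ s))) G) =
      diffOp (∏ s, X (g s, b (Fin.succ s))) (colD (a 0) (b 0) G) -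
      diffOp (colD (b 0) (a 0) (∏ s, X (g s, b (Fin.succ s)))) G := by
    intro g
    rw [diffOp_colD]; ring
  rw [h1]
  simp only [← Finset.mul_sum, ← colD_apply]
  simp only [h2, mul_sub, Finset.sum_sub_distrib]
  congr 1
  simp only [normalProd]
  rw [← Finset.sum_filter, Finset.sum_comm]
  refine Finset.sum_congr rfl fun g _ => ?_
  have := colD_prod (k := k) (b 0) (a 0) g (b ∘ Fin.succ)
  simp only [Function.comp_apply] at this
  rw [this, ← Finset.sum_filter, map_sum, LinearMap.sum_apply, Finset.mul_sum]
  rfl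

end Polarization

end Plucker

namespace Plucker

section Capelli

variable {k : Type} [Field k] {r n : ℕ}

theorem normalProd_smul {m : ℕ} (a b : Fin m → Fin r) (q : k) (G : S k r n) :
    normalProd a b (q • G) = q • normalProd a b G := by
  simp [normalProd, Finset.smul_sum]

theorem normalProd_zero_right {m : ℕ} (a b : Fin m → Fin r) :
    normalProd a b (0 : S k r n) = 0 := by
  simp [normalProd]

theorem sum_sign_normalProd {m : ℕ} (a : Fin m → Fin r) (ha : Function.Injective a) (q : k)
    (G : S k r n) (hG : ∀ a b, colD a b G = if a = b then q • G else 0) :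
    ∑ σ : Equiv.Perm (Fin m), ((Equiv.Perm.sign σ : ℤ) : S k r n) * normalProd a (a ∘ σ) G =
      (∏ s : Fin m, (q + (s : ℕ))) • G := by
  induction m with
  | zero => simp [normalProd]
  | succ m ih =>
    have key : ∀ (p : Fin (m + 1)) (e : Equiv.Perm (Fin m)),
        ((Equiv.Perm.sign (Equiv.Perm.decomposeFin.symm (p, e)) : ℤ) : S k r n) *
          normalProd a (a ∘ Equiv.Perm.decomposeFin.symm (p, e)) G =
        (if p = 0 then q else 1) • (((Equiv.Perm.sign e : ℤ) : S k r n) *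
          normalProd (a ∘ Fin.succ) ((a ∘ Fin.succ) ∘ e) G) := by
      intro p e
      rw [normalProd_succ, Equiv.Perm.decomposeFin.symm_sign]
      simp only [Function.comp_apply, Equiv.Perm.decomposeFin_symm_apply_zero,
        Equiv.Perm.decomposeFin_symm_apply_succ]
      refine Fin.cases ?_ (fun j => ?_) p
      · rw [Finset.sum_eq_zero]
        · have : (a ∘ (Equiv.Perm.decomposeFin.symm ((0 : Fin (m + 1)), e))) ∘ Fin.succ =
              (a ∘ Fin.succ) ∘ e := by
            funext s; simp
          rw [this]
          simp [hG, normalProd_smul]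
        · intro s _
          rw [if_neg]
          intro h
          simpa using ha h
      · rw [hG, if_neg (fun h : a 0 = a j.succ => by simpa using (ha h).symm), normalProd_zero_right,
          Finset.sum_eq_single (e.symm j)]
        · have : Function.update
              ((a ∘ (Equiv.Perm.decomposeFin.symm ((Fin.succ j : Fin (m + 1)), e))) ∘ Fin.succ)
              (e.symm j) (a (Fin.succ j)) = (a ∘ Fin.succ) ∘ e := by
            funext s
            by_cases hs : s = e.symm j
            · subst hs; simp
            · rw [Function.update_of_ne hs]
              simp only [Function.comp_apply, Equiv.Perm.decomposeFin_symm_apply_succ]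
              rw [Equiv.swap_apply_of_ne_of_ne (Fin.succ_ne_zero _)]
              intro h
              exact hs (by rw [← Fin.succ_injective _ h]; simp)
          rw [this]
          simp
        · intro s _ hs
          rw [if_neg]
          intro h
          have h1 := ha h
          rw [Equiv.swap_apply_of_ne_of_ne (Fin.succ_ne_zero _)] at h1
          · simp at h1
          · intro h
            exact hs (by rw [← Fin.succ_injective _ h]; simp)
        · simp
    rw [← Equiv.Perm.decomposeFin.symm.sum_comp, Fintype.sum_prod_type]
    simp only [key, ← Finset.smul_sum]
    rw [ih (a ∘ Fin.succ) (ha.comp (Fin.succ_injective _)), ← Finset.sum_smul, smul_smul,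
      Fin.prod_univ_castSucc, Fin.sum_univ_succ, mul_comm]
    simp

theorem minor_eq_sum (g : Fin r → Fin n) :
    minor k r n g = ∑ σ : Equiv.Perm (Fin r), ((Equiv.Perm.sign σ : ℤ) : S k r n) *
      ∏ s, X (g s, σ s) := by
  rw [minor, ← Matrix.det_transpose, Matrix.det_apply']
  rfl

theorem minor_comp_perm (g : Fin r → Fin n) (ρ : Equiv.Perm (Fin r)) :
    minor k r n (g ∘ ρ) = ((Equiv.Perm.sign ρ : ℤ) : S k r n) * minor k r n g := by
  rw [minor, minor, ← Matrix.det_permute]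
  rfl

theorem sum_prod_X_mul_diffOp_minor (q : k)
    (G : S k r n) (hG : ∀ a b, colD a b G = if a = b then q • G else 0) :
    ∑ g : Fin r → Fin n, (∏ s, X (g s, s)) * diffOp (minor k r n g) G =
      (∏ s : Fin r, (q + (s : ℕ))) • G := by
  rw [← sum_sign_normalProd id Function.injective_id q G hG]
  simp only [normalProd, minor_eq_sum, map_sum, LinearMap.sum_apply, Finset.mul_sum]
  rw [Finset.sum_comm]
  refine Finset.sum_congr rfl fun σ _ => Finset.sum_congr rfl fun g _ => ?_
  rcases Int.units_eq_one_or (Equiv.Perm.sign σ) with h | h <;> simp [h]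

theorem sum_minor_mul_diffOp_minor (q : k)
    (G : S k r n) (hG : ∀ a b, colD a b G = if a = b then q • G else 0) :
    ∑ g : Fin r → Fin n, minor k r n g * diffOp (minor k r n g) G =
      ((r.factorial : k) * ∏ s : Fin r, (q + (s : ℕ))) • G := by
  have h : ∀ σ : Equiv.Perm (Fin r), ∑ g : Fin r → Fin n,
      (((Equiv.Perm.sign σ : ℤ) : S k r n) * ∏ s, X (g s, σ s)) * diffOp (minor k r n g) G =
      (∏ s : Fin r, (q + (s : ℕ))) • G := by
    intro σ
    rw [← sum_prod_X_mul_diffOp_minor q G hG,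
      ← (Equiv.arrowCongr σ.symm (Equiv.refl (Fin n))).sum_comp]
    refine Finset.sum_congr rfl fun g _ => ?_
    have h1 : (Equiv.arrowCongr σ.symm (Equiv.refl (Fin n))) g = g ∘ σ := by
      funext s; simp [Equiv.arrowCongr]
    have h2 : ∏ s, (X ((g ∘ σ) s, σ s) : S k r n) = ∏ s, X (g s, s) :=
      Equiv.prod_comp σ fun s => (X (g s, s) : S k r n)
    rw [h1, h2, minor_comp_perm]
    rcases Int.units_eq_one_or (Equiv.Perm.sign σ) with h | h <;> simp [h]
  simp only [minor_eq_sum (k := k), Finset.sum_mul] at h ⊢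
  rw [Finset.sum_comm]
  simp only [h]
  simp [Fintype.card_perm, mul_smul, ← Nat.cast_smul_eq_nsmul k]

end Capelli

end Plucker

namespace MvPolynomial

variable {k : Type*} [CommRing k] {σ : Type*}

theorem coeff_sum_X_mul_pderiv [Fintype σ] (G : MvPolynomial σ k) (m : σ →₀ ℕ) :
    coeff m (∑ i, X i * pderiv i G) = (m.degree : k) * coeff m G := by
  classical
  induction G using MvPolynomial.induction_on' with
  | monomial u a =>
    simp_rw [X_mul_pderiv_monomial, ← Finset.sum_smul]
    rw [coeff_smul, coeff_monomial]
    split_ifs with h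
    · subst h
      rw [Finsupp.degree_eq_sum, nsmul_eq_mul]
    · simp
  | add p q hp hq =>
    simp only [map_add, mul_add, Finset.sum_add_distrib, coeff_add, hp, hq]

theorem homogeneousComponent_X_mul_pderiv (e : ℕ) (i j : σ) (G : MvPolynomial σ k) :
    homogeneousComponent e (X i * pderiv j G) = X i * pderiv j (homogeneousComponent e G) := by
  classical
  induction G using MvPolynomial.induction_on' with
  | monomial u a =>
    have h1 : (monomial u a).IsHomogeneous u.degree := isHomogeneous_monomial a rfl
    have h2 : (X i * pderiv j (monomial u a)).IsHomogeneous u.degree := by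
      rcases Nat.eq_zero_or_pos u.degree with h | h
      · rw [Finsupp.degree_eq_zero_iff] at h
        subst h
        simp [isHomogeneous_zero]
      · have := (isHomogeneous_X k i).mul (h1.pderiv (i := j))
        rwa [Nat.add_sub_cancel' h] at this
    rw [homogeneousComponent_of_mem h1, homogeneousComponent_of_mem h2]
    split_ifs <;> simp
  | add p q hp hq => simp only [map_add, mul_add, hp, hq]

end MvPolynomial

theorem Derivation.map_det_updateCol {R A : Type*} [CommRing R] [CommRing A] [Algebra R A]
    (D : Derivation R A A) {ι : Type*} [Fintype ι] [DecidableEq ι] (M : Matrix ι ι A) :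
    D M.det = ∑ i, (M.updateCol i fun j => D (M j i)).det := by
  simp only [Matrix.det_apply', map_sum, Derivation.leibniz, Derivation.map_intCast, smul_zero,
    add_zero, Derivation.map_prod_univ, Finset.smul_sum]
  rw [Finset.sum_comm]
  refine Finset.sum_congr rfl fun i _ => Finset.sum_congr rfl fun σ _ => ?_
  rw [smul_eq_mul]
  congr 1
  refine Finset.prod_congr rfl fun j _ => ?_
  by_cases h : j = i
  · subst h; simp
  · simp [h]

theorem Derivation.map_det_updateRow {R A : Type*} [CommRing R] [CommRing A] [Algebra R A]
    (D : Derivation R A A) {ι : Type*} [Fintype ι] [DecidableEq ι] (M : Matrix ι ι A) :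
    D M.det = ∑ i, (M.updateRow i fun j => D (M i j)).det := by
  rw [← Matrix.det_transpose, D.map_det_updateCol]
  refine Finset.sum_congr rfl fun i _ => ?_
  rw [← Matrix.det_transpose, ← Matrix.updateRow_transpose]
  rfl

namespace Plucker

section Invariants

variable {k : Type} [Field k] {r n : ℕ}

theorem colD_minor (a b : Fin r) (f : Fin r → Fin n) :
    colD a b (minor k r n f) = if a = b then minor k r n f else 0 := by
  rw [minor, Derivation.map_det_updateCol, Finset.sum_eq_single b]
  · simp only [Matrix.of_apply, colD_X, if_true]
    split_ifs with h
    · subst h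
      congr 1
      exact Matrix.updateCol_eq_self _ _
    · refine Matrix.det_zero_of_column_eq h fun i => ?_
      simp [Matrix.updateCol_ne h]
  · intro c _ hc
    refine Matrix.det_eq_zero_of_column_eq_zero c fun i => ?_
    simp [colD_X, hc]
  · simp

theorem colD_diffOp_minor (a b : Fin r) (f : Fin r → Fin n) {q : k} {G : S k r n}
    (hG : ∀ a b, colD a b G = if a = b then q • G else 0) :
    colD a b (diffOp (minor k r n f) G) =
      if a = b then (q - 1) • diffOp (minor k r n f) G else 0 := by
  have h := diffOp_colD (minor k r n f) G a b
  rw [hG, colD_minor] at h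
  rw [← sub_eq_iff_eq_add] at h
  rw [← h]
  by_cases hab : a = b
  · simp [hab, sub_smul]
  · simp [hab, Ne.symm hab]

theorem degree_mul_coeff {q : k} {G : S k r n}
    (hG : ∀ a, colD a a G = q • G) (m : Fin n × Fin r →₀ ℕ) :
    (m.degree : k) * coeff m G = r * q * coeff m G := by
  rw [← coeff_sum_X_mul_pderiv, Fintype.sum_prod_type, Finset.sum_comm]
  simp only [← colD_apply, hG, Finset.sum_const, Finset.card_univ, Fintype.card_fin]
  rw [← Nat.cast_smul_eq_nsmul k, smul_smul, coeff_smul, smul_eq_mul]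

theorem mem_algebra_of_colD [CharZero k] (hr : 0 < r) (N : ℕ) (q : k) (hq : (r : k) * q = N)
    (G : S k r n) (hG : ∀ a b, colD a b G = if a = b then q • G else 0) : G ∈ algebra k r n := by
  induction N using Nat.strong_induction_on generalizing q G with
  | _ N ih =>
  have hr0 : (r : k) ≠ 0 := by exact_mod_cast hr.ne'
  rcases Nat.eq_zero_or_pos N with rfl | hN
  · have : G = C (coeff 0 G) := by
      ext m
      rw [coeff_C]
      split_ifs with h
      · rw [h]
      · have := degree_mul_coeff (q := q) (G := G) (fun a => by simp [hG]) m
        rw [hq, Nat.cast_zero, zero_mul, mul_eq_zero, Nat.cast_eq_zero,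
          Finsupp.degree_eq_zero_iff] at this
        exact this.resolve_left (Ne.symm h)
    rw [this]
    exact (algebra k r n).algebraMap_mem _
  have hc : (r.factorial : k) * ∏ s : Fin r, (q + (s : ℕ)) ≠ 0 := by
    refine mul_ne_zero (by exact_mod_cast r.factorial_ne_zero) (Finset.prod_ne_zero_iff.2 ?_)
    intro s _ h
    have : (r : k) * (q + (s : ℕ)) = ((N + r * s : ℕ) : k) := by push_cast; rw [← hq]; ring
    rw [h, mul_zero] at this
    have : N + r * s = 0 := by exact_mod_cast this.symm
    omega
  have h1 := sum_minor_mul_diffOp_minor q G hG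
  have h2 : ∀ g : Fin r → Fin n, diffOp (minor k r n g) G ∈ algebra k r n := by
    intro g
    have hw := fun a b => colD_diffOp_minor a b g hG
    rcases lt_or_ge N r with hlt | hge
    · convert! (algebra k r n).zero_mem
      ext m
      have := degree_mul_coeff (q := q - 1) (fun a => by simpa using hw a a) m
      rw [← sub_eq_zero, ← sub_mul, mul_eq_zero] at this
      refine this.resolve_left fun h => ?_
      have h3 : ((m.degree + r : ℕ) : k) = (N : ℕ) := by
        push_cast; rw [← hq]; linear_combination h
      have : m.degree + r = N := by exact_mod_cast h3
      omega
    · refine ih (N - r) (by omega) (q - 1) ?_ _ hw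
      rw [Nat.cast_sub hge, ← hq]; ring
  have h3 : G = ((r.factorial : k) * ∏ s : Fin r, (q + (s : ℕ)))⁻¹ •
      ∑ g : Fin r → Fin n, minor k r n g * diffOp (minor k r n g) G := by
    rw [h1, smul_smul, inv_mul_cancel₀ hc, one_smul]
  rw [h3]
  exact (algebra k r n).smul_mem ((algebra k r n).sum_mem fun g _ =>
    (algebra k r n).mul_mem (Algebra.subset_adjoin ⟨g, rfl⟩) (h2 g)) _

end Invariants

end Plucker

namespace Plucker

section GradientSpan

variable {k : Type} [Field k] {r n : ℕ}

theorem minor_mem (f : Fin r → Fin n) : minor k r n f ∈ algebra k r n :=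
  Algebra.subset_adjoin ⟨f, rfl⟩

/-- The gradient of a polynomial, i.e. its differential in coordinates. -/
def grad (G : S k r n) : Fin n × Fin r → S k r n := fun p => pderiv p G

theorem grad_add (F G : S k r n) : grad (F + G) = grad F + grad G := by
  funext p; simp [grad]

theorem grad_mul (F G : S k r n) : grad (F * G) = F • grad G + G • grad F := by
  funext p; simp [grad]

variable (k r n) in
/-- The span over the Plücker algebra of the gradients of its elements. -/
def gradSpan : Submodule (algebra k r n) (Fin n × Fin r → S k r n) :=
  Submodule.span _ (Set.range fun G : algebra k r n => grad (G : S k r n))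

theorem grad_mem {G : S k r n} (hG : G ∈ algebra k r n) : grad G ∈ gradSpan k r n :=
  Submodule.subset_span ⟨⟨G, hG⟩, rfl⟩

theorem smul_mem_gradSpan {G : S k r n} (hG : G ∈ algebra k r n)
    {w : Fin n × Fin r → S k r n} (hw : w ∈ gradSpan k r n) : G • w ∈ gradSpan k r n :=
  (gradSpan k r n).smul_mem (⟨G, hG⟩ : algebra k r n) hw

theorem derivation_mem_algebra (D : Derivation k (S k r n) (S k r n))
    (hD : ∀ f, D (minor k r n f) ∈ algebra k r n) {G : S k r n} (hG : G ∈ algebra k r n) :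
    D G ∈ algebra k r n := by
  induction hG using Algebra.adjoin_induction with
  | mem x hx => obtain ⟨f, rfl⟩ := hx; exact hD f
  | algebraMap c => rw [Derivation.map_algebraMap]; exact zero_mem _
  | add x y _ _ hx hy => rw [map_add]; exact add_mem hx hy
  | mul x y hx' hy' hx hy =>
    rw [Derivation.leibniz]; exact add_mem (mul_mem hx' hy) (mul_mem hy' hx)

/-- The infinitesimal row operation `∑ₐ x_{ia} ∂/∂x_{ja}`. -/
def rowD (i j : Fin n) : Derivation k (S k r n) (S k r n) :=
  ∑ a, (X (i, a) : S k r n) • pderiv (j, a)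

theorem rowD_apply (i j : Fin n) (G : S k r n) :
    rowD i j G = ∑ a, X (i, a) * pderiv (j, a) G := by
  rw [← Derivation.coeFnAddMonoidHom_apply, rowD, map_sum, Finset.sum_apply]
  rfl

theorem rowD_X (i j l : Fin n) (c : Fin r) :
    rowD i j (X (l, c) : S k r n) = if l = j then X (i, c) else 0 := by
  simp only [rowD_apply, pderiv_X, Pi.single_apply, Prod.mk.injEq]
  split_ifs with h <;> simp [h]

theorem rowD_minor (i j : Fin n) (f : Fin r → Fin n) :
    rowD i j (minor k r n f) =
      ∑ s, if f s = j then minor k r n (Function.update f s i) else 0 := by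
  rw [minor, Derivation.map_det_updateRow]
  refine Finset.sum_congr rfl fun s _ => ?_
  simp only [Matrix.of_apply, rowD_X]
  split_ifs with h
  · rw [minor]
    congr 1
    ext t c
    by_cases hts : t = s
    · subst hts; simp
    · simp [hts]
  · exact Matrix.det_eq_zero_of_row_eq_zero s fun c => by simp

theorem rowD_mem (i j : Fin n) {G : S k r n} (hG : G ∈ algebra k r n) :
    rowD i j G ∈ algebra k r n := by
  refine derivation_mem_algebra _ (fun f => ?_) hG
  rw [rowD_minor]
  refine sum_mem fun s _ => ?_
  split_ifs
  · exact minor_mem _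
  · exact zero_mem _

theorem sum_rowD_minor_mul_X (i : Fin n) (b : Fin r) (f : Fin r → Fin n) :
    ∑ l, rowD i l (minor k r n f) * X (l, b) = minor k r n f * X (i, b) := by
  have h := congrFun (Matrix.mulVec_cramer
    (Matrix.of fun s c : Fin r => (X (f s, c) : S k r n)).transpose fun c => X (i, c)) b
  simp only [Matrix.mulVec, dotProduct, Matrix.cramer_transpose_apply, Matrix.det_transpose,
    Pi.smul_apply, smul_eq_mul, Matrix.transpose_apply, Matrix.of_apply] at h
  rw [show minor k r n f * X (i, b) = _ from h.symm]
  simp only [rowD_minor, Finset.sum_mul]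
  rw [Finset.sum_comm]
  refine Finset.sum_congr rfl fun s _ => ?_
  simp only [ite_mul, zero_mul, Finset.sum_ite_eq, Finset.mem_univ, if_true]
  rw [mul_comm, minor]
  congr 2
  ext t c
  by_cases hts : t = s
  · subst hts; simp
  · simp [hts]

theorem pderiv_pderiv_minor_eq_zero (j l : Fin n) (c : Fin r) (f : Fin r → Fin n) :
    pderiv (j, c) (pderiv (l, c) (minor k r n f)) = 0 := by
  rw [minor, Derivation.map_det_updateCol, map_sum]
  refine Finset.sum_eq_zero fun a _ => ?_
  by_cases ha : a = c
  · subst ha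
    rw [Derivation.map_det_updateCol]
    refine Finset.sum_eq_zero fun b _ => ?_
    refine Matrix.det_eq_zero_of_column_eq_zero b fun s => ?_
    rw [Matrix.updateCol_self]
    by_cases hb : b = a
    · subst hb
      rw [Matrix.updateCol_self, Matrix.of_apply, pderiv_X, Pi.single_apply]
      split_ifs <;> simp
    · rw [Matrix.updateCol_ne hb, Matrix.of_apply, pderiv_X, Pi.single_apply, if_neg]
      simp [hb]
  · rw [Matrix.det_eq_zero_of_column_eq_zero a fun s => ?_, map_zero]
    rw [Matrix.updateCol_self, Matrix.of_apply, pderiv_X, Pi.single_apply, if_neg]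
    simp [ha]

theorem pderiv_colD (p : Fin n × Fin r) (a b : Fin r) (G : S k r n) :
    pderiv p (colD a b G) = colD a b (pderiv p G) + if p.2 = a then pderiv (p.1, b) G else 0 := by
  obtain ⟨i, c⟩ := p
  simp only [colD_apply, map_sum, Derivation.leibniz, smul_eq_mul, pderiv_X, Pi.single_apply,
    Finset.sum_add_distrib, Prod.mk.injEq]
  refine congrArg₂ (· + ·) ?_ ?_
  · exact Finset.sum_congr rfl fun j _ => by rw [pderiv_comm_apply]
  · by_cases h : c = a
    · simp [h]
    · simp [h, Ne.symm h]

theorem pderiv_pderiv_minor_antisymm (j l : Fin n) (a b : Fin r) (f : Fin r → Fin n) :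
    pderiv (j, b) (pderiv (l, a) (minor k r n f)) =
      -pderiv (j, a) (pderiv (l, b) (minor k r n f)) := by
  by_cases hab : a = b
  · subst hab; simp [pderiv_pderiv_minor_eq_zero]
  have h := congrArg (fun G => pderiv (l, a) (pderiv (j, a) G)) (colD_minor (k := k) a b f)
  simp only [hab, if_false, map_zero, pderiv_colD, map_add, if_true,
    pderiv_pderiv_minor_eq_zero] at h
  rw [pderiv_comm_apply (j, b), pderiv_comm_apply (j, a)]
  rw [zero_add, add_comm] at h
  exact eq_neg_of_add_eq_zero_left h

end GradientSpan

end Plucker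

namespace Plucker

section Reconstruction

variable {k : Type} [Field k] {r n : ℕ}

variable (k r n) in
/-- The Euler derivation. -/
def eulerD : Derivation k (S k r n) (S k r n) := ∑ a, colD a a

theorem eulerD_apply (G : S k r n) : eulerD k r n G = ∑ a, colD a a G := by
  rw [← Derivation.coeFnAddMonoidHom_apply, eulerD, map_sum, Finset.sum_apply]
  rfl

theorem eulerD_eq_smul {q : k} {G : S k r n} (hG : ∀ a, colD a a G = q • G) :
    eulerD k r n G = (r * q) • G := by
  rw [eulerD_apply]
  simp only [hG, Finset.sum_const, Finset.card_univ, Fintype.card_fin]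
  rw [← Nat.cast_smul_eq_nsmul k, smul_smul]

theorem eulerD_minor (f : Fin r → Fin n) :
    eulerD k r n (minor k r n f) = (r : k) • minor k r n f := by
  rw [eulerD_eq_smul (q := 1) (fun a => by simp [colD_minor]), mul_one]

theorem smul_mem_algebra (c : k) {G : S k r n} (hG : G ∈ algebra k r n) : c • G ∈ algebra k r n :=
  (algebra k r n).smul_mem hG c

theorem smul_mem_gradSpan' (c : k) {w : Fin n × Fin r → S k r n} (hw : w ∈ gradSpan k r n) :
    c • w ∈ gradSpan k r n := by
  have := smul_mem_gradSpan ((algebra k r n).algebraMap_mem c) hw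
  rwa [algebraMap_smul] at this

/-- The `j`-th row of the gradient of `G`, moved to the `i`-th row. -/
def rowGrad (i j : Fin n) (G : S k r n) : Fin n × Fin r → S k r n :=
  fun p => if p.1 = i then pderiv (j, p.2) G else 0

/-- The defect of `secondOrder` from being a derivation. -/
def defect (i j : Fin n) (F G : S k r n) : Fin n × Fin r → S k r n :=
  (r : k)⁻¹ • eulerD k r n F • rowGrad i j G - ∑ l, rowD i l F • rowGrad l j G

/-- A second order operator mapping the Plücker algebra to the span of its gradients. -/
def secondOrder (i j : Fin n) (G : S k r n) : Fin n × Fin r → S k r n := fun p =>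
  (r : k)⁻¹ • rowGrad i j (eulerD k r n G) p -
    ∑ a, X (i, a) * pderiv (j, p.2) (pderiv (p.1, a) G)

theorem defect_apply (i j : Fin n) (G G' : S k r n) (u : Fin n) (b : Fin r) :
    defect i j G G' (u, b) = (r : k)⁻¹ • (eulerD k r n G *
      if u = i then pderiv (j, b) G' else 0) - rowD i u G * pderiv (j, b) G' := by
  simp [defect, rowGrad, Finset.sum_apply]

theorem secondOrder_mul (i j : Fin n) (G G' : S k r n) :
    secondOrder i j (G * G') = G • secondOrder i j G' + G' • secondOrder i j G +
      (defect i j G G' + defect i j G' G) := by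
  funext ⟨u, b⟩
  simp only [Pi.add_apply, Pi.smul_apply, defect_apply, secondOrder, rowGrad, Derivation.leibniz,
    map_add, smul_eq_mul, mul_add, Finset.sum_add_distrib, rowD_apply, mul_sub, Finset.mul_sum,
    Finset.sum_mul]
  have h1 : ∑ x, X (i, x) * (G * pderiv (j, b) (pderiv (u, x) G')) =
    ∑ x, G * (X (i, x) * pderiv (j, b) (pderiv (u, x) G')) :=
      Finset.sum_congr rfl fun _ _ => by ring
  have h2 : ∑ x, X (i, x) * (G' * pderiv (j, b) (pderiv (u, x) G)) =
    ∑ x, G' * (X (i, x) * pderiv (j, b) (pderiv (u, x) G)) :=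
      Finset.sum_congr rfl fun _ _ => by ring
  have h3 : ∑ x, X (i, x) * (pderiv (u, x) G' * pderiv (j, b) G) =
    ∑ x, X (i, x) * pderiv (u, x) G' * pderiv (j, b) G :=
      Finset.sum_congr rfl fun _ _ => by ring
  have h4 : ∑ x, X (i, x) * (pderiv (u, x) G * pderiv (j, b) G') =
    ∑ x, X (i, x) * pderiv (u, x) G * pderiv (j, b) G' :=
      Finset.sum_congr rfl fun _ _ => by ring
  rw [h1, h2, h3, h4]
  split_ifs
  · simp only [smul_eq_C_mul]; ring
  · simp only [smul_eq_C_mul]; ring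

theorem defect_minor [CharZero k] (hr : 0 < r) (i j : Fin n) (f : Fin r → Fin n) (G : S k r n) :
    defect i j (minor k r n f) G = ∑ l, rowD l j G • grad (rowD i l (minor k r n f)) -
      rowD i j G • grad (minor k r n f) := by
  have hr0 : (r : k) ≠ 0 := by exact_mod_cast hr.ne'
  funext ⟨u, b⟩
  have h : ∀ a, ∑ l, X (l, a) * pderiv (u, b) (rowD i l (minor k r n f)) -
      X (i, a) * pderiv (u, b) (minor k r n f) = 
      if a = b then (if u = i then minor k r n f else 0) - rowD i u (minor k r n f) else 0 := by
    intro a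
    have h := congrArg (pderiv (u, b)) (sum_rowD_minor_mul_X (k := k) i a f)
    simp only [map_sum, Derivation.leibniz, smul_eq_mul, Finset.sum_add_distrib, pderiv_X,
      Pi.single_apply, Prod.mk.injEq] at h
    by_cases hab : a = b
    · subst hab
      simp only [and_true, mul_ite, mul_one, mul_zero, Finset.sum_ite_eq', Finset.mem_univ,
        if_true] at h ⊢
      simp only [eq_comm (a := u)]
      linear_combination h
    · simp only [hab, and_false, if_false, mul_zero, Finset.sum_const_zero, zero_add] at h ⊢
      rw [h, sub_self]
  have h' : ∑ l, rowD l j G * pderiv (u, b) (rowD i l (minor k r n f)) -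
      rowD i j G * pderiv (u, b) (minor k r n f) =
      ∑ a, pderiv (j, a) G * (∑ l, X (l, a) * pderiv (u, b) (rowD i l (minor k r n f)) -
      X (i, a) * pderiv (u, b) (minor k r n f)) := by
    simp only [mul_sub, Finset.sum_sub_distrib, Finset.mul_sum, rowD_apply _ _ G, Finset.sum_mul]
    rw [Finset.sum_comm]
    refine congrArg₂ (· - ·) ?_ ?_
    · exact Finset.sum_congr rfl fun _ _ => Finset.sum_congr rfl fun _ _ => by ring
    · exact Finset.sum_congr rfl fun _ _ => by ring
  simp only [defect_apply, Pi.sub_apply, Finset.sum_apply, Pi.smul_apply, smul_eq_mul, grad]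
  rw [h', eulerD_minor, smul_mul_assoc, smul_smul, inv_mul_cancel₀ hr0, one_smul]
  simp only [h, mul_ite, mul_zero, Finset.sum_ite_eq', Finset.mem_univ, if_true]
  split_ifs <;> ring

theorem defect_mem [CharZero k] (hr : 0 < r) (i j : Fin n) {G G' : S k r n}
    (hG : G ∈ algebra k r n) (hG' : G' ∈ algebra k r n) : defect i j G G' ∈ gradSpan k r n := by
  induction hG using Algebra.adjoin_induction with
  | mem x hx =>
    obtain ⟨f, rfl⟩ := hx
    rw [defect_minor hr]
    exact sub_mem (sum_mem fun l _ => smul_mem_gradSpan (rowD_mem _ _ hG')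
      (grad_mem (rowD_mem _ _ (minor_mem f))))
      (smul_mem_gradSpan (rowD_mem _ _ hG') (grad_mem (minor_mem f)))
  | algebraMap c =>
    convert! (gradSpan k r n).zero_mem
    simp [defect]
  | add x y _ _ hx hy =>
    convert! add_mem hx hy using 1
    simp only [defect, map_add, add_smul, smul_add, Finset.sum_add_distrib]
    abel
  | mul x y hx' hy' hx hy =>
    convert! add_mem (smul_mem_gradSpan hx' hy) (smul_mem_gradSpan hy' hx) using 1
    funext ⟨u, b⟩
    simp only [Pi.add_apply, Pi.smul_apply, defect_apply, Derivation.leibniz, smul_eq_mul,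
      smul_eq_C_mul]
    ring

theorem secondOrder_mem [CharZero k] (hr : 0 < r) (i j : Fin n) {G : S k r n}
    (hG : G ∈ algebra k r n) : secondOrder i j G ∈ gradSpan k r n := by
  have hr0 : (r : k) ≠ 0 := by exact_mod_cast hr.ne'
  induction hG using Algebra.adjoin_induction with
  | mem x hx =>
    obtain ⟨f, rfl⟩ := hx
    convert! grad_mem (rowD_mem i j (minor_mem (k := k) f)) using 1
    funext ⟨u, b⟩
    simp only [secondOrder, rowGrad, eulerD_minor, grad, rowD_apply, map_sum, Derivation.leibniz,
      smul_eq_mul, Finset.sum_add_distrib, pderiv_X, Pi.single_apply, Prod.mk.injEq]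
    rw [sub_eq_add_neg, add_comm, ← Finset.sum_neg_distrib]
    refine congrArg₂ (· + ·) ?_ ?_
    · refine Finset.sum_congr rfl fun a _ => ?_
      rw [pderiv_pderiv_minor_antisymm, pderiv_comm_apply (j, a)]
      ring
    · by_cases h : u = i
      · simp [h, smul_smul, inv_mul_cancel₀ hr0]
      · simp [h, Ne.symm h]
  | algebraMap c =>
    convert! (gradSpan k r n).zero_mem
    funext p
    simp [secondOrder, rowGrad]
  | add x y _ _ hx hy =>
    convert! add_mem hx hy using 1
    funext p
    simp only [secondOrder, rowGrad, map_add, mul_add, Finset.sum_add_distrib, Pi.add_apply]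
    split_ifs
    · rw [smul_add]; abel
    · simp only [smul_zero]; abel
  | mul x y hx' hy' hx hy =>
    rw [secondOrder_mul]
    exact add_mem (add_mem (smul_mem_gradSpan hx' hy) (smul_mem_gradSpan hy' hx))
      (add_mem (defect_mem hr i j hx' hy') (defect_mem hr i j hy' hx'))

theorem mem_gradSpan_of_colD [CharZero k] (hr : 0 < r) (hrn : r ≤ n) (N : ℕ) (hN : 0 < N) (q : k)
    (hq : (r : k) * q = N) (w : Fin n × Fin r → S k r n) (F : S k r n)
    (h1 : ∀ a b j c, colD a b (w (j, c)) + (if c = a then w (j, b) else 0) =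
      if a = b then q • w (j, c) else 0)
    (h2 : ∀ a b, ∑ j, X (j, a) * w (j, b) = if a = b then F else 0) :
    w ∈ gradSpan k r n := by
  have hr0 : (r : k) ≠ 0 := by exact_mod_cast hr.ne'
  set H : Fin n → Fin n → S k r n := fun i j => ∑ b, X (i, b) * w (j, b) with hH
  have hw : ∀ a b j c, colD a b (w (j, c)) =
      (if a = b then q • w (j, c) else 0) - (if c = a then w (j, b) else 0) :=
    fun a b j c => eq_sub_of_add_eq (h1 a b j c)
  have hHD : ∀ i j a b, colD a b (H i j) = if a = b then q • H i j else 0 := by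
    intro i j a b
    simp only [hH, map_sum, Derivation.leibniz, smul_eq_mul, colD_X, hw, mul_sub,
      Finset.sum_add_distrib, Finset.sum_sub_distrib, mul_ite, mul_zero, Finset.sum_ite_eq',
      Finset.mem_univ, if_true]
    rw [mul_comm (w (j, b)), sub_add_cancel]
    split_ifs
    · rw [Finset.smul_sum]
      exact Finset.sum_congr rfl fun _ _ => mul_smul_comm _ _ _
    · simp
  have hHmem : ∀ i j, H i j ∈ algebra k r n := fun i j =>
    mem_algebra_of_colD hr N q hq _ (hHD i j)
  have hF : F ∈ algebra k r n := by
    have : F = (r : k)⁻¹ • ∑ j, H j j := by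
      simp only [hH]
      rw [Finset.sum_comm]
      simp only [h2, if_true, Finset.sum_const, Finset.card_univ, Fintype.card_fin]
      rw [← Nat.cast_smul_eq_nsmul k, smul_smul, inv_mul_cancel₀ hr0, one_smul]
    rw [this]
    exact smul_mem_algebra _ (sum_mem fun j _ => hHmem j j)
  have h3 : ∀ u b, ∑ j, pderiv (j, b) (H j u) = ((n : k) + q - r) • w (u, b) := by
    intro u b
    simp only [hH, map_sum, Derivation.leibniz, smul_eq_mul, Finset.sum_add_distrib, pderiv_X,
      Pi.single_apply, Prod.mk.injEq, true_and, mul_ite, mul_one, mul_zero, Finset.sum_ite_eq',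
      Finset.mem_univ, if_true, Finset.sum_const, Finset.card_univ, Fintype.card_fin]
    rw [Finset.sum_comm]
    simp only [← colD_apply, hw, Finset.sum_sub_distrib, Finset.sum_ite_eq',
      Finset.mem_univ, if_true, Finset.sum_const, Finset.card_univ, Fintype.card_fin,
      ← Nat.cast_smul_eq_nsmul k]
    module
  have h4 : ∀ u b, ∑ i, ∑ a, X (i, a) * pderiv (u, a) (w (i, b)) =
      pderiv (u, b) F - (r : k) • w (u, b) := by
    intro u b
    have h5 : ∀ a, ∑ i, X (i, a) * pderiv (u, a) (w (i, b)) =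
        (if a = b then pderiv (u, b) F else 0) - w (u, b) := by
      intro a
      have h6 := congrArg (pderiv (u, a)) (h2 a b)
      simp only [map_sum, Derivation.leibniz, smul_eq_mul, Finset.sum_add_distrib, pderiv_X,
        Pi.single_apply, Prod.mk.injEq, and_true, mul_ite, mul_one, mul_zero, Finset.sum_ite_eq',
        Finset.mem_univ, if_true] at h6
      rw [eq_sub_iff_add_eq]
      by_cases hab : a = b
      · subst hab; simpa using h6
      · simpa [hab] using h6
    rw [Finset.sum_comm]
    simp [h5, ← Nat.cast_smul_eq_nsmul k]
  have h5 : ∑ i, ∑ j, secondOrder i j (H j i) =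
      ((n : k) + q - r) • ((q + r) • w - grad F) := by
    funext ⟨u, b⟩
    simp only [Finset.sum_apply, secondOrder, rowGrad, Finset.sum_sub_distrib, Pi.smul_apply,
      Pi.sub_apply, grad]
    have e1 : ∀ i j, eulerD k r n (H j i) = ((r : k) * q) • H j i := fun i j =>
      eulerD_eq_smul fun a => by simpa using hHD j i a a
    have e2 : ∑ i, ∑ j, (r : k)⁻¹ • (if u = i then pderiv (j, b) (eulerD k r n (H j i)) else 0) =
        q • ((n : k) + q - r) • w (u, b) := by
      rw [← h3]
      simp only [← Finset.smul_sum]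
      rw [Finset.sum_comm]
      simp only [Finset.sum_ite_eq, Finset.mem_univ, if_true, e1, Derivation.map_smul, ← Finset.smul_sum]
      rw [smul_smul, inv_mul_cancel_left₀ hr0]
    have e3 : ∑ i, ∑ j, ∑ a, X (i, a) * pderiv (j, b) (pderiv (u, a) (H j i)) =
        ((n : k) + q - r) • (pderiv (u, b) F - (r : k) • w (u, b)) := by
      rw [← h4, Finset.smul_sum]
      refine Finset.sum_congr rfl fun i _ => ?_
      rw [Finset.sum_comm, Finset.smul_sum]
      refine Finset.sum_congr rfl fun a _ => ?_
      simp only [pderiv_comm_apply (_, b)]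
      rw [← Finset.mul_sum, ← map_sum, h3, Derivation.map_smul, mul_smul_comm]
    rw [e2, e3]
    module
  have hc1 : (n : k) + q - r ≠ 0 := by
    intro h
    have : ((N + r * (n - r) : ℕ) : k) = 0 := by
      push_cast [Nat.cast_sub hrn]
      rw [← hq]
      linear_combination (r : k) * h
    have : N + r * (n - r) = 0 := by exact_mod_cast this
    omega
  have hc2 : q + r ≠ 0 := by
    intro h
    have : ((N + r * r : ℕ) : k) = 0 := by
      push_cast
      rw [← hq]
      linear_combination (r : k) * h
    have : N + r * r = 0 := by exact_mod_cast this
    omega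
  have h6 : w = (q + r)⁻¹ • (((n : k) + q - r)⁻¹ • (∑ i, ∑ j, secondOrder i j (H j i)) +
      grad F) := by
    rw [h5, smul_smul, inv_mul_cancel₀ hc1, one_smul, sub_add_cancel, smul_smul,
      inv_mul_cancel₀ hc2, one_smul]
  rw [h6]
  exact smul_mem_gradSpan' _ (add_mem (smul_mem_gradSpan' _ (sum_mem fun i _ => sum_mem fun j _ =>
    secondOrder_mem hr i j (hHmem j i))) (grad_mem hF))

end Reconstruction

end Plucker

theorem MvPolynomial.homogeneousComponent_X_mul {k σ : Type*} [CommRing k] (e : ℕ) (i : σ)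
    (G : MvPolynomial σ k) :
    homogeneousComponent (e + 1) (X i * G) = X i * homogeneousComponent e G := by
  classical
  induction G using MvPolynomial.induction_on' with
  | monomial u a =>
    have h1 : (monomial u a).IsHomogeneous u.degree := isHomogeneous_monomial a rfl
    have h2 := (isHomogeneous_X k i).mul h1
    rw [add_comm 1] at h2
    rw [homogeneousComponent_of_mem h1, homogeneousComponent_of_mem h2]
    by_cases h : e = u.degree <;> simp [h]
  | add p q hp hq => simp only [map_add, mul_add, hp, hq]

namespace Plucker

section Saturation

variable {k : Type} [Field k] {r n : ℕ}

/-- The action of the infinitesimal column operations on vector valued polynomials which makes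
`grad` equivariant. -/
def colAct (a b : Fin r) (w : Fin n × Fin r → S k r n) : Fin n × Fin r → S k r n :=
  fun p => colD a b (w p) + if p.2 = a then w (p.1, b) else 0

/-- The contraction of a differential form with an infinitesimal column operation. -/
def colContract (a b : Fin r) (w : Fin n × Fin r → S k r n) : S k r n :=
  ∑ j, X (j, a) * w (j, b)

/-- Differential forms which are semi-invariant and horizontal modulo scalars. -/
structure IsBasic (w : Fin n × Fin r → S k r n) : Prop where
  colAct_eq_zero : ∀ a b, a ≠ b → colAct a b w = 0
  colAct_eq : ∀ a b, colAct a a w = colAct b b w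
  colContract_eq_zero : ∀ a b, a ≠ b → colContract a b w = 0
  colContract_eq : ∀ a b, colContract a a w = colContract b b w

theorem colAct_add (a b : Fin r) (v w : Fin n × Fin r → S k r n) :
    colAct a b (v + w) = colAct a b v + colAct a b w := by
  funext p
  simp only [colAct, Pi.add_apply, map_add]
  split_ifs <;> ring

theorem colAct_smul (a b : Fin r) (G : S k r n) (w : Fin n × Fin r → S k r n) :
    colAct a b (G • w) = G • colAct a b w + colD a b G • w := by
  funext p
  simp only [colAct, Pi.add_apply, Pi.smul_apply, smul_eq_mul, Derivation.leibniz]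
  split_ifs <;> ring

theorem colAct_grad (a b : Fin r) (G : S k r n) : colAct a b (grad G) = grad (colD a b G) := by
  funext p
  simp only [colAct, grad, pderiv_colD]

theorem colContract_add (a b : Fin r) (v w : Fin n × Fin r → S k r n) :
    colContract a b (v + w) = colContract a b v + colContract a b w := by
  simp [colContract, mul_add, Finset.sum_add_distrib]

theorem colContract_smul (a b : Fin r) (G : S k r n) (w : Fin n × Fin r → S k r n) :
    colContract a b (G • w) = G * colContract a b w := by
  simp only [colContract, Finset.mul_sum, Pi.smul_apply, smul_eq_mul]
  exact Finset.sum_congr rfl fun _ _ => by ring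

theorem colContract_grad (a b : Fin r) (G : S k r n) :
    colContract a b (grad G) = colD a b G := by
  rw [colD_apply]; rfl

theorem colD_eq_zero_of_mem {G : S k r n} (hG : G ∈ algebra k r n) {a b : Fin r} (h : a ≠ b) :
    colD a b G = 0 := by
  induction hG using Algebra.adjoin_induction with
  | mem x hx => obtain ⟨f, rfl⟩ := hx; rw [colD_minor, if_neg h]
  | algebraMap c => rw [Derivation.map_algebraMap]
  | add x y _ _ hx hy => rw [map_add, hx, hy, add_zero]
  | mul x y _ _ hx hy => rw [Derivation.leibniz, hx, hy, smul_zero, smul_zero, add_zero]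

theorem colD_eq_of_mem {G : S k r n} (hG : G ∈ algebra k r n) (a b : Fin r) :
    colD a a G = colD b b G := by
  induction hG using Algebra.adjoin_induction with
  | mem x hx => obtain ⟨f, rfl⟩ := hx; simp [colD_minor]
  | algebraMap c => rw [Derivation.map_algebraMap, Derivation.map_algebraMap]
  | add x y _ _ hx hy => rw [map_add, hx, hy, map_add]
  | mul x y _ _ hx hy => rw [Derivation.leibniz, hx, hy, Derivation.leibniz]

theorem isBasic_of_mem_gradSpan {w : Fin n × Fin r → S k r n} (hw : w ∈ gradSpan k r n) :
    IsBasic w := by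
  induction hw using Submodule.span_induction with
  | mem x hx =>
    obtain ⟨⟨G, hG⟩, rfl⟩ := hx
    refine ⟨fun a b h => ?_, fun a b => ?_, fun a b h => ?_, fun a b => ?_⟩
    · rw [colAct_grad, colD_eq_zero_of_mem hG h]; funext p; simp [grad]
    · rw [colAct_grad, colAct_grad, colD_eq_of_mem hG a b]
    · rw [colContract_grad, colD_eq_zero_of_mem hG h]
    · rw [colContract_grad, colContract_grad, colD_eq_of_mem hG a b]
  | zero =>
    have h1 : ∀ a b, colAct a b (0 : Fin n × Fin r → S k r n) = 0 := by
      intro a b; funext p; simp [colAct]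
    have h2 : ∀ a b, colContract a b (0 : Fin n × Fin r → S k r n) = 0 := by
      intro a b; simp [colContract]
    exact ⟨fun a b _ => h1 a b, fun a b => by rw [h1, h1], fun a b _ => h2 a b,
      fun a b => by rw [h2, h2]⟩
  | add x y _ _ hx hy =>
    refine ⟨fun a b h => ?_, fun a b => ?_, fun a b h => ?_, fun a b => ?_⟩
    · rw [colAct_add, hx.1 a b h, hy.1 a b h, add_zero]
    · rw [colAct_add, hx.2 a b, hy.2 a b, colAct_add]
    · rw [colContract_add, hx.3 a b h, hy.3 a b h, add_zero]
    · rw [colContract_add, hx.4 a b, hy.4 a b, colContract_add]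
  | smul G x _ hx =>
    have hGx : G • x = (G : S k r n) • x := rfl
    rw [hGx]
    refine ⟨fun a b h => ?_, fun a b => ?_, fun a b h => ?_, fun a b => ?_⟩
    · rw [colAct_smul, hx.1 a b h, colD_eq_zero_of_mem G.2 h, smul_zero, zero_smul, add_zero]
    · rw [colAct_smul, colAct_smul, hx.2 a b, colD_eq_of_mem G.2 a b]
    · rw [colContract_smul, hx.3 a b h, mul_zero]
    · rw [colContract_smul, colContract_smul, hx.4 a b]

theorem IsBasic.of_smul {G : S k r n} (hG : G ∈ algebra k r n) (hG0 : G ≠ 0)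
    {w : Fin n × Fin r → S k r n} (hw : IsBasic (G • w)) : IsBasic w := by
  have hinj : Function.Injective fun v : Fin n × Fin r → S k r n => G • v := by
    intro u v huv
    funext p
    exact mul_left_cancel₀ hG0 (congrFun huv p)
  refine ⟨fun a b h => hinj ?_, fun a b => hinj ?_, fun a b h => ?_, fun a b => ?_⟩
  · have := hw.1 a b h
    rw [colAct_smul, colD_eq_zero_of_mem hG h, zero_smul, add_zero] at this
    simpa using this
  · have := hw.2 a b
    rw [colAct_smul, colAct_smul, colD_eq_of_mem hG a b] at this
    exact add_right_cancel this
  · have := hw.3 a b h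
    rw [colContract_smul] at this
    exact (mul_eq_zero.1 this).resolve_left hG0
  · have := hw.4 a b
    rw [colContract_smul, colContract_smul] at this
    exact mul_left_cancel₀ hG0 this

theorem homogeneousComponent_colD (e : ℕ) (a b : Fin r) (G : S k r n) :
    homogeneousComponent e (colD a b G) = colD a b (homogeneousComponent e G) := by
  simp only [colD_apply, map_sum, homogeneousComponent_X_mul_pderiv]

/-- The componentwise homogeneous component of a vector valued polynomial. -/
def component (e : ℕ) (w : Fin n × Fin r → S k r n) : Fin n × Fin r → S k r n :=
  fun p => homogeneousComponent e (w p)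

theorem colAct_component (e : ℕ) (a b : Fin r) (w : Fin n × Fin r → S k r n) :
    colAct a b (component e w) = component e (colAct a b w) := by
  funext p
  simp only [colAct, component, map_add, homogeneousComponent_colD]
  split_ifs <;> simp

theorem colContract_component (e : ℕ) (a b : Fin r) (w : Fin n × Fin r → S k r n) :
    colContract a b (component e w) = homogeneousComponent (e + 1) (colContract a b w) := by
  simp only [colContract, component, map_sum, homogeneousComponent_X_mul]

theorem sum_colAct_component (e : ℕ) (w : Fin n × Fin r → S k r n) :
    ∑ a, colAct a a (component e w) = ((e + 1 : ℕ) : k) • component e w := by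
  funext ⟨j, c⟩
  have h := (homogeneousComponent_isHomogeneous e (w (j, c))).sum_X_mul_pderiv
  rw [Fintype.sum_prod_type, Finset.sum_comm] at h
  simp only [← colD_apply] at h
  simp only [Finset.sum_apply, colAct, component, Finset.sum_add_distrib, h, Finset.sum_ite_eq,
    Finset.mem_univ, if_true, Pi.smul_apply]
  rw [← Nat.cast_smul_eq_nsmul k]
  push_cast
  module

theorem component_mem_gradSpan [CharZero k] (hr : 0 < r) (hrn : r ≤ n)
    {w : Fin n × Fin r → S k r n} (hw : IsBasic w) (e : ℕ) :
    component e w ∈ gradSpan k r n := by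
  have hr0 : (r : k) ≠ 0 := by exact_mod_cast hr.ne'
  set q : k := (r : k)⁻¹ * ((e + 1 : ℕ) : k) with hq
  have h1 : ∀ a, colAct a a (component e w) = q • component e w := by
    intro a
    have h2 : ∀ b, colAct b b (component e w) = colAct a a (component e w) := fun b => by
      rw [colAct_component, colAct_component, hw.2 a b]
    have h3 := sum_colAct_component e w
    simp only [h2, Finset.sum_const, Finset.card_univ, Fintype.card_fin] at h3
    rw [hq, mul_smul, ← h3, ← Nat.cast_smul_eq_nsmul k, smul_smul, inv_mul_cancel₀ hr0, one_smul]
  refine mem_gradSpan_of_colD hr hrn (e + 1) e.succ_pos q (mul_inv_cancel_left₀ hr0 _) _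
    (colContract ⟨0, hr⟩ ⟨0, hr⟩ (component e w)) ?_ ?_
  · intro a b j c
    change colAct a b (component e w) (j, c) = _
    split_ifs with h
    · rw [h, h1]; rfl
    · rw [colAct_component, hw.1 a b h]; simp [component]
  · intro a b
    change colContract a b (component e w) = _
    split_ifs with h
    · subst h
      rw [colContract_component, colContract_component, hw.4 a]
    · rw [colContract_component, hw.3 a b h, map_zero]

theorem exists_sum_component (w : Fin n × Fin r → S k r n) :
    ∃ D, ∑ e ∈ Finset.range D, component e w = w := by
  refine ⟨∑ p, ((w p).totalDegree + 1), ?_⟩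
  funext p
  have hp : (w p).totalDegree + 1 ≤ ∑ p, ((w p).totalDegree + 1) :=
    Finset.single_le_sum (f := fun p => (w p).totalDegree + 1) (fun _ _ => Nat.zero_le _)
      (Finset.mem_univ p)
  conv_rhs => rw [← sum_homogeneousComponent (w p)]
  rw [Finset.sum_apply]
  refine (Finset.sum_subset (Finset.range_subset_range.2 hp) fun e _ he => ?_).symm
  rw [Finset.mem_range, not_lt] at he
  exact homogeneousComponent_eq_zero _ _ he

theorem IsBasic.mem_gradSpan [CharZero k] (hr : 0 < r) (hrn : r ≤ n)
    {w : Fin n × Fin r → S k r n} (hw : IsBasic w) : w ∈ gradSpan k r n := by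
  obtain ⟨D, hD⟩ := exists_sum_component w
  rw [← hD]
  exact sum_mem fun e _ => component_mem_gradSpan hr hrn hw e

theorem mem_gradSpan_of_smul_mem [CharZero k] (hr : 0 < r) (hrn : r ≤ n) {G : S k r n}
    (hG : G ∈ algebra k r n) (hG0 : G ≠ 0) {w : Fin n × Fin r → S k r n}
    (hw : G • w ∈ gradSpan k r n) : w ∈ gradSpan k r n :=
  ((isBasic_of_mem_gradSpan hw).of_smul hG hG0).mem_gradSpan hr hrn

end Saturation

end Plucker

namespace Plucker

section Coprimality

variable {k : Type} [Field k] {r n : ℕ}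

theorem minor_ne_zero {f : Fin r → Fin n} (hf : Function.Injective f) : minor k r n f ≠ 0 := by
  intro h
  have h1 := congrArg (eval fun p : Fin n × Fin r => if p.1 = f p.2 then (1 : k) else 0) h
  rw [minor, RingHom.map_det, map_zero] at h1
  have h2 : (eval fun p : Fin n × Fin r => if p.1 = f p.2 then (1 : k) else 0).mapMatrix
      (Matrix.of fun i j : Fin r => (X (f i, j) : S k r n)) = 1 := by
    ext i j
    simp [Matrix.one_apply, hf.eq_iff]
  rw [h2, Matrix.det_one] at h1
  exact one_ne_zero h1

theorem minor_mem_supported (f : Fin r → Fin n) :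
    minor k r n f ∈ supported k {p : Fin n × Fin r | p.1 ∈ Set.range f} := by
  rw [minor_eq_sum]
  refine sum_mem fun σ _ => mul_mem ?_ (prod_mem fun s _ => X_mem_supported.2 ⟨s, rfl⟩)
  exact intCast_mem _ _

theorem exists_injective_forall_ne (hrn : r < n) (i : Fin n) :
    ∃ f : Fin r → Fin n, Function.Injective f ∧ ∀ s, f s ≠ i := by
  obtain ⟨m, rfl⟩ := Nat.exists_eq_add_of_lt hrn
  have h : r ≤ r + m := by omega
  exact ⟨fun s => i.succAbove (Fin.castLE h s),
    Fin.succAbove_right_injective.comp (Fin.castLE_injective h), fun s => Fin.succAbove_ne _ _⟩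

theorem isUnit_of_forall_dvd_minor_pow (hrn : r < n) (t : ℕ) {d : S k r n}
    (hd : ∀ f : Fin r → Fin n, Function.Injective f → d ∣ minor k r n f ^ t) : IsUnit d := by
  have h : ∀ p, d.degreeOf p = 0 := by
    intro p
    obtain ⟨f, hf, hfp⟩ := exists_injective_forall_ne hrn p.1
    obtain ⟨e, he⟩ := hd f hf
    have hne : minor k r n f ^ t ≠ 0 := pow_ne_zero _ (minor_ne_zero hf)
    have h1 : (minor k r n f ^ t).degreeOf p = 0 := by
      by_contra h
      have h2 := mem_supported.1 (pow_mem (minor_mem_supported (k := k) f) t)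
        (mem_vars_iff_degreeOf_ne_zero.2 h)
      obtain ⟨s, hs⟩ := h2
      exact hfp s hs
    rw [he] at hne h1
    rw [degreeOf_mul_eq (left_ne_zero_of_mul hne) (right_ne_zero_of_mul hne)] at h1
    omega
  have h1 : d.vars = ∅ := by
    refine Finset.eq_empty_of_forall_notMem fun p hp => ?_
    exact mem_vars_iff_degreeOf_ne_zero.1 hp (h p)
  rw [vars_eq_empty_iff_eq_C] at h1
  obtain ⟨f, hf, -⟩ := exists_injective_forall_ne hrn ⟨0, by omega⟩
  have hd0 : d ≠ 0 := by
    rintro rfl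
    exact pow_ne_zero t (minor_ne_zero hf) (zero_dvd_iff.1 (hd f hf))
  rw [h1] at hd0 ⊢
  exact (isUnit_iff_ne_zero.2 fun h => hd0 (by rw [h, C_0])).map C

theorem minor_pow_dvd (hrn : r < n) (t : ℕ) (u : (Fin r → Fin n) → S k r n)
    (hu : ∀ f g, minor k r n g ^ t * u f = minor k r n f ^ t * u g)
    {f : Fin r → Fin n} (hf : Function.Injective f) : minor k r n f ^ t ∣ u f := by
  obtain ⟨a, b, c, hab, ha, hb⟩ := UniqueFactorizationMonoid.exists_reduced_factors
    (minor k r n f ^ t) (pow_ne_zero t (minor_ne_zero hf)) (u f)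
  have hc : c ≠ 0 := by
    rintro rfl
    rw [zero_mul] at ha
    exact pow_ne_zero t (minor_ne_zero hf) ha.symm
  have hunit : IsUnit a := by
    refine isUnit_of_forall_dvd_minor_pow hrn t fun g _ => ?_
    have h1 := hu f g
    rw [← ha, ← hb, mul_left_comm, mul_assoc] at h1
    exact hab.dvd_of_dvd_mul_right ⟨u g, mul_left_cancel₀ hc h1⟩
  rw [← ha, ← hb]
  exact mul_dvd_mul_left _ hunit.dvd

end Coprimality

end Plucker

section Derivations

variable {k A M : Type*} [CommRing k] [CommRing A] [Algebra k A] [AddCommGroup M] [Module A M]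
  [Module k M]

/-- The subalgebra of elements whose derivative lies in a given submodule. -/
def Derivation.preimage (D : Derivation k A M) (V : Submodule A M) : Subalgebra k A where
  carrier := {a | D a ∈ V}
  mul_mem' {a b} ha hb := by
    rw [Set.mem_ofPred_eq, D.leibniz]
    exact add_mem (V.smul_mem _ hb) (V.smul_mem _ ha)
  add_mem' {a b} ha hb := by
    rw [Set.mem_ofPred_eq, map_add]
    exact add_mem ha hb
  algebraMap_mem' c := by
    rw [Set.mem_ofPred_eq, D.map_algebraMap]
    exact zero_mem _

theorem Derivation.smul_mem_of_mul_mem (D : Derivation k A M) {V : Submodule A M} {a b : A}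
    (ha : a ∈ D.preimage V) (hab : a * b ∈ D.preimage V) : a • D b ∈ V := by
  have h : D (a * b) ∈ V := hab
  rw [D.leibniz] at h
  exact (V.add_mem_iff_left (V.smul_mem b ha)).1 h

theorem Derivation.smul_mem_of_adjoin_eq_top (D : Derivation k A M) {V : Submodule A M} {d : A}
    {s : Set A} (hs : Algebra.adjoin k s = ⊤) (h : ∀ a ∈ s, d • D a ∈ V) (a : A) : d • D a ∈ V := by
  have h1 : Algebra.adjoin k s ≤ D.preimage (V.comap (LinearMap.lsmul A M d)) :=
    Algebra.adjoin_le h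
  exact h1 (hs ▸ Algebra.mem_top)

theorem KaehlerDifferential.smul_mem_of_forall {V : Submodule A (Ω[A⁄k])} {d : A}
    (h : ∀ a, d • KaehlerDifferential.D k A a ∈ V) (x : Ω[A⁄k]) : d • x ∈ V := by
  have h1 : Submodule.span A (Set.range (KaehlerDifferential.D k A)) ≤
      V.comap (LinearMap.lsmul A _ d) := by
    rw [Submodule.span_le]
    rintro _ ⟨a, rfl⟩
    exact h a
  rw [KaehlerDifferential.span_range_derivation] at h1
  exact h1 Submodule.mem_top

theorem LinearMap.smul_apply_comm {N : Type*} [AddCommGroup N] [Module A N] {I : Ideal A}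
    (φ : I →ₗ[A] N) (x y : I) : (x : A) • φ y = (y : A) • φ x := by
  rw [← map_smul, ← map_smul]
  congr 1
  exact Subtype.ext (mul_comm _ _)

theorem LinearMap.apply_eq_smul_of_comp_eq {N : Type*} [AddCommGroup N] [Module A N]
    {I : Ideal A} {ψ : M →ₗ[A] N} {K : ℕ} (hK : ∀ a ∈ I ^ K, ∀ x, ψ x = 0 → a • x = 0) {t : ℕ}
    {φ : ↥(I ^ t) →ₗ[A] M} {ω : M} (hω : ∀ x, ψ (φ x) = (x : A) • ψ ω) (x : A)
    (hx : x ∈ I ^ (K + t)) :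
    φ ⟨x, Ideal.pow_le_pow_right (Nat.le_add_left t K) hx⟩ = x • ω := by
  have key : ∀ x ∈ I ^ K * I ^ t, ∃ hx : x ∈ I ^ t, φ ⟨x, hx⟩ = x • ω := by
    intro x hx
    induction hx using Submodule.mul_induction_on' with
    | mem_mul_mem a ha b hb =>
      refine ⟨Ideal.mul_mem_left _ _ hb, ?_⟩
      have h1 : ψ (φ ⟨b, hb⟩ - b • ω) = 0 := by
        rw [map_sub, map_smul, sub_eq_zero]
        exact hω ⟨b, hb⟩
      have h2 := hK a ha _ h1
      rw [smul_sub, sub_eq_zero, ← map_smul, smul_smul] at h2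
      exact h2
    | add x _ y _ hx hy =>
      obtain ⟨hx, hx'⟩ := hx
      obtain ⟨hy, hy'⟩ := hy
      refine ⟨add_mem hx hy, ?_⟩
      rw [add_smul, ← hx', ← hy', ← map_add]
      rfl
  rw [pow_add] at hx
  exact (key x hx).2

theorem Subalgebra.det_mem {ι : Type*} [Fintype ι] [DecidableEq ι] (B : Subalgebra k A)
    {N : Matrix ι ι A} (hN : ∀ i j, N i j ∈ B) : N.det ∈ B := by
  rw [Matrix.det_apply']
  exact sum_mem fun σ _ => mul_mem (intCast_mem _ _) (prod_mem fun i _ => hN _ _)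

end Derivations

namespace Plucker

section Torsion

variable {k : Type} [Field k] {r n : ℕ}

theorem minor_update_apply {f : Fin r → Fin n} (b b' : Fin r) :
    minor k r n (Function.update f b (f b')) = if b' = b then minor k r n f else 0 := by
  split_ifs with h
  · rw [h, Function.update_eq_self]
  · refine Matrix.det_zero_of_row_eq h ?_
    funext c
    simp [h]

theorem minor_pow_mul_minor (f J : Fin r → Fin n) :
    minor k r n f ^ (r - 1) * minor k r n J =
      (Matrix.of fun s b => minor k r n (Function.update f b (J s))).det := by
  set N : Matrix (Fin r) (Fin r) (S k r n) := Matrix.of fun i j => X (f i, j) with hN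
  have h : (Matrix.of fun s b => minor k r n (Function.update f b (J s))) =
      Matrix.of (fun i j : Fin r => (X (J i, j) : S k r n)) * N.adjugate := by
    ext s b : 1
    have h1 := Matrix.cramer_transpose_apply N (fun c => X (J s, c)) b
    rw [Matrix.cramer_eq_adjugate_mulVec, ← Matrix.adjugate_transpose] at h1
    rw [Matrix.of_apply, Matrix.mul_apply, minor]
    simp only [Matrix.mulVec, dotProduct, Matrix.transpose_apply] at h1
    rw [show ∑ c, Matrix.of (fun i j : Fin r => (X (J i, j) : S k r n)) s c * N.adjugate c b =
      ∑ c, N.adjugate c b * X (J s, c) from Finset.sum_congr rfl fun _ _ => mul_comm _ _, h1]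
    congr 1
    ext t c : 1
    by_cases htb : t = b
    · subst htb; simp
    · simp [hN, htb]
  rw [h, Matrix.det_mul, Matrix.det_adjugate, Fintype.card_fin, mul_comm]
  rfl

theorem rowD_minor_update {f : Fin r → Fin n} {j : Fin n} (hj : ∀ s, f s ≠ j) (b b' : Fin r)
    (l : Fin n) : rowD (f b') j (minor k r n (Function.update f b l)) =
      if l = j ∧ b' = b then minor k r n f else 0 := by
  rw [rowD_minor, Finset.sum_eq_single b]
  · rw [Function.update_self, Function.update_idem, minor_update_apply, ite_and]
  · intro s _ hs
    rw [Function.update_of_ne hs, if_neg (hj s)]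
  · simp

theorem linearIndependent_grad_minor (hr : 0 < r) {f : Fin r → Fin n}
    (hf : Function.Injective f) (c : {j // ∀ s, f s ≠ j} × Fin r → S k r n) (a : S k r n)
    (h : ∑ p, c p • grad (minor k r n (Function.update f p.2 p.1)) + a • grad (minor k r n f) = 0) :
    (∀ p, c p = 0) ∧ a = 0 := by
  have hc : ∀ p, c p = 0 := by
    rintro ⟨⟨j, hj⟩, b'⟩
    have h1 := congrArg (fun w : Fin n × Fin r → S k r n => ∑ d, X (f b', d) * w (j, d)) h
    simp only [Pi.add_apply, Finset.sum_apply, Pi.smul_apply, Pi.zero_apply, smul_eq_mul, mul_zero,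
      Finset.sum_const_zero, mul_add, Finset.sum_add_distrib, Finset.mul_sum, grad] at h1
    rw [Finset.sum_comm] at h1
    simp only [mul_left_comm (X _), ← Finset.mul_sum, ← rowD_apply] at h1
    rw [rowD_minor (f b') j f, Finset.sum_eq_zero fun s _ => if_neg (hj s), mul_zero,
      add_zero, Finset.sum_eq_single ⟨⟨j, hj⟩, b'⟩] at h1
    · rw [rowD_minor_update hj, if_pos ⟨rfl, rfl⟩] at h1
      exact (mul_eq_zero.1 h1).resolve_right (minor_ne_zero hf)
    · rintro ⟨⟨l, hl⟩, b⟩ - hne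
      rw [rowD_minor_update hj, if_neg, mul_zero]
      rintro ⟨h2, h3⟩
      exact hne (by simp only at h2 h3; subst h2 h3; rfl)
    · simp
  refine ⟨hc, ?_⟩
  simp only [hc, zero_smul, Finset.sum_const_zero, zero_add] at h
  have h1 := congrArg (colContract ⟨0, hr⟩ ⟨0, hr⟩) h
  rw [colContract_smul, colContract_grad, colD_minor, if_pos rfl] at h1
  refine (mul_eq_zero.1 (h1.trans ?_)).resolve_right (minor_ne_zero hf)
  simp [colContract]

/-- The Plücker coordinates. -/
def coord (f : Fin r → Fin n) : algebra k r n := ⟨minor k r n f, minor_mem f⟩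

theorem coord_pow_mul_coord (f J : Fin r → Fin n) :
    (coord f ^ (r - 1) * coord J : algebra k r n) =
      (Matrix.of fun s b => coord (k := k) (Function.update f b (J s))).det := by
  refine Subtype.ext ((minor_pow_mul_minor f J).trans ?_)
  rw [← Subalgebra.coe_val, AlgHom.map_det]
  rfl

variable (k r n) in
theorem adjoin_range_coord :
    Algebra.adjoin k (Set.range (coord : (Fin r → Fin n) → algebra k r n)) = ⊤ := by
  refine Eq.trans ?_ (Algebra.adjoin_adjoin_coe_preimage (s := Set.range (minor k r n)))
  congr 1
  ext a
  exact ⟨fun ⟨f, hf⟩ => ⟨f, congrArg Subtype.val hf⟩, fun ⟨f, hf⟩ => ⟨f, Subtype.ext hf⟩⟩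

variable (k r n) in
/-- The gradient as a derivation of the Plücker algebra. -/
def gradD : Derivation k (algebra k r n) (Fin n × Fin r → S k r n) :=
  Derivation.mk'
    { toFun := fun G => grad (G : S k r n)
      map_add' := fun _ _ => grad_add _ _
      map_smul' := fun c G => by funext p; simp [grad] }
    fun F G => grad_mul _ _

variable (k r n) in
/-- The map from Kähler differentials to gradients. -/
def gradLinear : Ω[algebra k r n⁄k] →ₗ[algebra k r n] (Fin n × Fin r → S k r n) :=
  (gradD k r n).liftKaehlerDifferential

theorem gradLinear_D (G : algebra k r n) :
    gradLinear k r n (KaehlerDifferential.D k _ G) = grad (G : S k r n) :=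
  Derivation.liftKaehlerDifferential_comp_D _ _

theorem range_gradLinear : LinearMap.range (gradLinear k r n) = gradSpan k r n := by
  rw [LinearMap.range_eq_map, ← KaehlerDifferential.span_range_derivation, Submodule.map_span,
    ← Set.range_comp, gradSpan]
  congr 2
  funext G
  exact gradLinear_D G

/-- The submodule of Kähler differentials which generates them on the chart given by `f`. -/
def chart (f : Fin r → Fin n) : Submodule (algebra k r n) (Ω[algebra k r n⁄k]) :=
  Submodule.span _ (Set.range fun p : {j // ∀ s, f s ≠ j} × Fin r =>
    KaehlerDifferential.D k (algebra k r n) (coord (Function.update f p.2 p.1))) ⊔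
  Submodule.span _ {KaehlerDifferential.D k (algebra k r n) (coord f)}

theorem D_coord_mem_chart (f : Fin r → Fin n) :
    KaehlerDifferential.D k (algebra k r n) (coord f) ∈ chart f :=
  Submodule.mem_sup_right (Submodule.mem_span_singleton_self _)

theorem D_coord_update_mem_chart (f : Fin r → Fin n) (b : Fin r) (j : Fin n) :
    KaehlerDifferential.D k (algebra k r n) (coord (Function.update f b j)) ∈ chart f := by
  by_cases hj : ∀ s, f s ≠ j
  · exact Submodule.mem_sup_left (Submodule.subset_span ⟨(⟨j, hj⟩, b), rfl⟩)
  · push Not at hj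
    obtain ⟨b', rfl⟩ := hj
    by_cases h : b' = b
    · rw [h, Function.update_eq_self]
      exact D_coord_mem_chart f
    · have h0 : coord (k := k) (Function.update f b (f b')) = 0 :=
        Subtype.ext ((minor_update_apply b b').trans (if_neg h))
      rw [h0, map_zero]
      exact zero_mem _

theorem coord_pow_smul_mem_chart (f : Fin r → Fin n) (x : Ω[algebra k r n⁄k]) :
    (coord f : algebra k r n) ^ (r - 1) • x ∈ chart f := by
  refine KaehlerDifferential.smul_mem_of_forall (Derivation.smul_mem_of_adjoin_eq_top _
    (adjoin_range_coord k r n) ?_) x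
  rintro _ ⟨J, rfl⟩
  have h2 : coord f ^ (r - 1) * coord J ∈
      (KaehlerDifferential.D k (algebra k r n)).preimage (chart f) := by
    rw [coord_pow_mul_coord]
    exact Subalgebra.det_mem _ fun s b => D_coord_update_mem_chart f b (J s)
  exact Derivation.smul_mem_of_mul_mem _ (Subalgebra.pow_mem _ (D_coord_mem_chart f) _) h2

theorem eq_zero_of_mem_chart (hr : 0 < r) {f : Fin r → Fin n} (hf : Function.Injective f)
    {x : Ω[algebra k r n⁄k]} (hx : x ∈ chart f) (hx0 : gradLinear k r n x = 0) : x = 0 := by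
  obtain ⟨y, hy, z, hz, rfl⟩ := Submodule.mem_sup.1 hx
  obtain ⟨c, rfl⟩ := (Submodule.mem_span_range_iff_exists_fun _).1 hy
  obtain ⟨a, rfl⟩ := Submodule.mem_span_singleton.1 hz
  simp only [map_add, map_sum, map_smul, gradLinear_D] at hx0
  obtain ⟨h1, h2⟩ := linearIndependent_grad_minor hr hf (fun p => (c p : S k r n)) a hx0
  have h3 : ∀ p, c p = 0 := fun p => Subtype.ext (h1 p)
  have h4 : a = 0 := Subtype.ext h2
  simp [h3, h4]

theorem coord_pow_smul_eq_zero (hr : 0 < r) (f : Fin r → Fin n) {x : Ω[algebra k r n⁄k]}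
    (hx : gradLinear k r n x = 0) : (coord f : algebra k r n) ^ r • x = 0 := by
  by_cases hf : Function.Injective f
  · have h := eq_zero_of_mem_chart hr hf (coord_pow_smul_mem_chart f x) (by
      rw [map_smul, hx, smul_zero])
    rw [← mul_pow_sub_one hr.ne', mul_smul, h, smul_zero]
  · have h0 : (coord f : algebra k r n) = 0 := by
      simp only [Function.Injective, not_forall] at hf
      obtain ⟨a, b, hab, hne⟩ := hf
      refine Subtype.ext (Matrix.det_zero_of_row_eq hne ?_)
      funext c
      simp [hab]
    rw [h0, zero_pow hr.ne', zero_smul]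

theorem irrelevant_eq_span : irrelevant k r n = Ideal.span (Set.range coord) := by
  rw [irrelevant]
  congr 1
  ext a
  exact ⟨fun ⟨f, hf⟩ => ⟨f, Subtype.ext hf.symm⟩, fun ⟨f, hf⟩ => ⟨f, hf ▸ rfl⟩⟩

theorem coord_mem (f : Fin r → Fin n) : coord f ∈ irrelevant k r n :=
  Ideal.subset_span ⟨f, rfl⟩

variable (k n) in
theorem exists_irrelevant_pow_smul_eq_zero (hr : 0 < r) : ∃ K, ∀ a ∈ irrelevant k r n ^ K,
    ∀ x, gradLinear k r n x = 0 → a • x = 0 := by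
  have h1 : irrelevant k r n ≤ (LinearMap.ker (gradLinear k r n)).annihilator.radical := by
    rw [irrelevant_eq_span, Ideal.span_le]
    rintro _ ⟨f, rfl⟩
    exact ⟨r, Submodule.mem_annihilator.2 fun x hx => coord_pow_smul_eq_zero hr f hx⟩
  have h2 : (irrelevant k r n).FG := by
    rw [irrelevant_eq_span]
    exact Submodule.fg_span (Set.finite_range _)
  obtain ⟨K, hK⟩ := Ideal.exists_pow_le_of_le_radical_of_fg h1 h2
  exact ⟨K, fun a ha x hx => Submodule.mem_annihilator.1 (hK ha) x hx⟩

end Torsion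

section Extension

variable {k : Type} [Field k] {r n : ℕ}

theorem exists_eq_smul (hrn : r < n) (t : ℕ)
    (φ : ↥(irrelevant k r n ^ t) →ₗ[algebra k r n] (Fin n × Fin r → S k r n)) :
    ∃ ω : Fin n × Fin r → S k r n, ∀ x, φ x = (x : algebra k r n) • ω := by
  have hmem : ∀ f, (coord f : algebra k r n) ^ t ∈ irrelevant k r n ^ t := fun f =>
    Ideal.pow_mem_pow (coord_mem f) t
  obtain ⟨f, hf, -⟩ := exists_injective_forall_ne hrn ⟨0, by omega⟩
  have hdvd : ∀ p, minor k r n f ^ t ∣ φ ⟨_, hmem f⟩ p := fun p =>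
    minor_pow_dvd hrn t (fun g => φ ⟨_, hmem g⟩ p)
      (fun g g' => congrFun (LinearMap.smul_apply_comm φ ⟨_, hmem g'⟩ ⟨_, hmem g⟩) p) hf
  choose ω hω using hdvd
  refine ⟨ω, fun x => ?_⟩
  funext p
  refine mul_left_cancel₀ (pow_ne_zero t (minor_ne_zero (k := k) hf)) ?_
  refine (congrFun (LinearMap.smul_apply_comm φ ⟨_, hmem f⟩ x) p).trans ?_
  change (x : S k r n) * φ ⟨_, hmem f⟩ p = _
  rw [hω, mul_left_comm]
  rfl

theorem exists_eq_smul_of_pow [CharZero k] (hr : 0 < r) (hrn : r < n) (t : ℕ)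
    (φ : ↥(irrelevant k r n ^ t) →ₗ[algebra k r n] Ω[algebra k r n⁄k]) :
    ∃ s, ∃ hst : t ≤ s, ∃ ω : Ω[algebra k r n⁄k], ∀ (x : algebra k r n)
      (hx : x ∈ irrelevant k r n ^ s), φ ⟨x, Ideal.pow_le_pow_right hst hx⟩ = x • ω := by
  obtain ⟨w, hw⟩ := exists_eq_smul hrn t (gradLinear k r n ∘ₗ φ)
  obtain ⟨f, hf, -⟩ := exists_injective_forall_ne hrn ⟨0, by omega⟩
  have hmem : (coord f : algebra k r n) ^ t ∈ irrelevant k r n ^ t :=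
    Ideal.pow_mem_pow (coord_mem f) t
  have hwg : w ∈ gradSpan k r n := by
    refine mem_gradSpan_of_smul_mem hr hrn.le (pow_mem (minor_mem f) t)
      (pow_ne_zero t (minor_ne_zero hf)) ?_
    have h := hw ⟨_, hmem⟩
    rw [← range_gradLinear]
    exact ⟨φ ⟨_, hmem⟩, h⟩
  rw [← range_gradLinear] at hwg
  obtain ⟨ω, rfl⟩ := hwg
  obtain ⟨K, hK⟩ := exists_irrelevant_pow_smul_eq_zero k n hr
  exact ⟨K + t, Nat.le_add_left _ _, ω, LinearMap.apply_eq_smul_of_comp_eq hK hw⟩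

end Extension

end Plucker

end

/-- **(Christophersen–Ilten, Proposition 4.9.)**  Let `k` be a field of
characteristic zero and `A` the Plücker algebra of the Grassmannian `G(r,E)`
with `dim E = n` (`0 < r < n`), with irrelevant maximal ideal `m`.  Then the
first local cohomology of the module of Kähler differentials vanishes:
`H^1_m(Ω_{A/k}) = 0`. -/
theorem h1_irrelevant_kaehler_plucker_vanishing
    (k : Type) [Field k] [CharZero k] (r n : ℕ) (hr : 0 < r) (hrn : r < n) :
    Subsingleton ((localCohomology (Plucker.irrelevant k r n) 1).obj
      (ModuleCat.of (Plucker.algebra k r n)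
        (Ω[(Plucker.algebra k r n)⁄k]))) := by
  exact localCohomology_one_subsingleton _ _ (Plucker.exists_eq_smul_of_pow hr hrn)

end
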